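/- arXiv:2508.14333 — 2 statements merged into one kernel-verified Lean document; each statement's English description precedes it below -/
import Mathlib

section
/- There exists a constant C > 0 such that the following holds. Let (x, p, μ) and (x', p', μ') be in 𝕋^d × ℝ^d × P(𝕋^d), and suppose v, v' ∈ C²(𝕋^d) and l, l' ∈ ℝ satisfy −tr(a D²v(y)) + H(x, y, p, Dv(y), μ) = l and −tr(a D²v'(y)) + H(x', y, p', Dv'(y), μ') = l' for all y ∈ 𝕋^d. Then |l − l'| ≤ C(1 + |p| + |p'|)(d(x,x') + |p − p'| + d₁(μ, μ')). In other words, the effective Hamiltonian H̄ satisfies |H̄(x,p,μ) − H̄(x',p',μ')| ≤ C(1+|p|+|p'|)(|x−x'| + |p−p'| + d₁(μ,μ')). -/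
noncomputable section

open MeasureTheory Metric Filter
open scoped RealInnerProductSpace ENNReal Topology

instance : Fact ((0:ℝ) < 1) := ⟨one_pos⟩

/-- Euclidean space `ℝ^d`. -/
abbrev Euc (d : ℕ) := EuclideanSpace ℝ (Fin d)

/-- The flat torus `𝕋^d = ℝ^d/ℤ^d`, realized as a product of circles. -/
abbrev Torus (d : ℕ) := Fin d → AddCircle (1 : ℝ)

/-- Canonical projection `ℝ^d → 𝕋^d`. -/
def Torus.proj {d : ℕ} (y : Euc d) : Torus d := fun i => (y i : AddCircle (1 : ℝ))

/-- The 1-Wasserstein distance between two (probability) measures on a metric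
measurable space: the infimum over all couplings of the expected distance. -/
def W1 {X : Type*} [MeasurableSpace X] [PseudoMetricSpace X] (μ ν : Measure X) : ℝ :=
  ⨅ π : {π : Measure (X × X) //
      IsProbabilityMeasure π ∧ π.map Prod.fst = μ ∧ π.map Prod.snd = ν},
    ∫ z, dist z.1 z.2 ∂(π : Measure (X × X))

/-- `P(𝕋^d)`: Borel probability measures on the torus. -/
abbrev ProbT (d : ℕ) := ProbabilityMeasure (Torus d)

/-- 1-Wasserstein distance on `P(𝕋^d)`. -/
def W1T {d : ℕ} (μ ν : ProbT d) : ℝ := W1 (μ : Measure (Torus d)) (ν : Measure (Torus d))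

/-- Second partial derivative `∂²v/∂yᵢ∂yⱼ`. -/
def hess {d : ℕ} (v : Euc d → ℝ) (y : Euc d) (i j : Fin d) : ℝ :=
  iteratedFDeriv ℝ 2 v y ![EuclideanSpace.single i 1, EuclideanSpace.single j 1]

/-- `tr(a D²v)(y)` for a constant matrix `a`. -/
def trAH {d : ℕ} (a : Matrix (Fin d) (Fin d) ℝ) (v : Euc d → ℝ) (y : Euc d) : ℝ :=
  ∑ i, ∑ j, a i j * hess v y j i

/-- The `ℤ^d`-periodic lift of a function on the torus. -/
def tlift {d : ℕ} (v : Torus d → ℝ) : Euc d → ℝ := fun y => v (Torus.proj y)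

/-- `v ∈ C²(𝕋^d)` together with `l ∈ ℝ` solve the ergodic cell problem
`−tr(a D²v(y)) + H(x, y, p, Dv(y), μ) = l` on `𝕋^d`. -/
def IsErgSol {d : ℕ} (a : Matrix (Fin d) (Fin d) ℝ)
    (H : Torus d → Torus d → Euc d → Euc d → ProbT d → ℝ)
    (x : Torus d) (p : Euc d) (μ : ProbT d) (v : Torus d → ℝ) (l : ℝ) : Prop :=
  ContDiff ℝ 2 (tlift v) ∧
  ∀ y : Euc d,
    -trAH a (tlift v) y + H x (Torus.proj y) p (gradient (tlift v) y) μ = l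

/-- First- and second-order necessary conditions at a local maximum on the line. -/
lemma IsLocalMax.deriv_eq_zero_and_deriv2_nonpos {g g' : ℝ → ℝ} {m t₀ : ℝ}
    (hg : ∀ t, HasDerivAt g (g' t) t) (hg' : HasDerivAt g' m t₀) (hmax : IsLocalMax g t₀) :
    g' t₀ = 0 ∧ m ≤ 0 := by
  have h0 : g' t₀ = 0 := hmax.hasDerivAt_eq_zero (hg t₀)
  refine ⟨h0, ?_⟩
  by_contra! hm
  have hd : deriv g = g' := funext fun t => (hg t).deriv
  have hmin : IsLocalMin g t₀ :=
    isLocalMin_of_deriv_deriv_pos (by rw [hd, hg'.deriv]; exact hm) (by rw [hd, h0])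
      (hg t₀).continuousAt
  have hconst : g =ᶠ[𝓝 t₀] fun _ => g t₀ := by
    filter_upwards [hmax, hmin] with t h1 h2 using le_antisymm h1 h2
  have hz : g' =ᶠ[𝓝 t₀] fun _ => 0 := by
    have := hconst.deriv
    rw [hd] at this
    simpa using this
  have : m = 0 := (hg'.congr_of_eventuallyEq hz.symm).unique (hasDerivAt_const t₀ (0 : ℝ))
  exact hm.ne' this

/-- A function on the line that is maximal on `[0, ∞)` at `0` has nonpositive derivative there. -/
lemma HasDerivAt.nonpos_of_forall_le {g : ℝ → ℝ} {m : ℝ} (hg : HasDerivAt g m 0)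
    (h : ∀ t, 0 ≤ t → g t ≤ g 0) : m ≤ 0 := by
  have hs := (hasDerivWithinAt_iff_tendsto_slope' (s := Set.Ioi (0 : ℝ)) (by simp)).1
    hg.hasDerivWithinAt
  refine le_of_tendsto hs ?_
  filter_upwards [self_mem_nhdsWithin] with t ht
  have ht : 0 < t := ht
  rw [slope_def_field, sub_zero]
  exact div_nonpos_of_nonpos_of_nonneg (by linarith [h t ht.le]) ht.le

section Lines

variable {E : Type*} [NormedAddCommGroup E] [NormedSpace ℝ E] {u : E → ℝ}

lemma hasDerivAt_add_smul (y ξ : E) (t : ℝ) : HasDerivAt (fun s : ℝ => y + s • ξ) ξ t := by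
  simpa using ((hasDerivAt_id t).smul_const ξ).const_add y

lemma ContDiff.hasDerivAt_comp_line (hu : ContDiff ℝ 2 u) (y ξ : E) (t : ℝ) :
    HasDerivAt (fun s : ℝ => u (y + s • ξ)) (fderiv ℝ u (y + t • ξ) ξ) t :=
  ((hu.differentiable (by norm_num)) (y + t • ξ)).hasFDerivAt.comp_hasDerivAt t
    (hasDerivAt_add_smul y ξ t)

lemma ContDiff.hasDerivAt_fderiv_comp_line (hu : ContDiff ℝ 2 u) (y ξ : E) (t : ℝ) :
    HasDerivAt (fun s : ℝ => fderiv ℝ u (y + s • ξ) ξ)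
      (fderiv ℝ (fderiv ℝ u) (y + t • ξ) ξ ξ) t := by
  have hd : Differentiable ℝ (fderiv ℝ u) :=
    (hu.fderiv_right (m := 1) (by norm_num)).differentiable (by norm_num)
  have h := (hd (y + t • ξ)).hasFDerivAt.comp_hasDerivAt t (hasDerivAt_add_smul y ξ t)
  exact h.clm_apply (hasDerivAt_const t ξ) |>.congr_deriv (by simp)

end Lines

lemma fderiv_fderiv_apply_eq_sum_hess {d : ℕ} (u : Euc d → ℝ) (y ξ : Euc d) :
    fderiv ℝ (fderiv ℝ u) y ξ ξ = ∑ i, ∑ j, ξ i * ξ j * hess u y i j := by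
  have hξ : ξ = ∑ i, ξ i • EuclideanSpace.single i (1 : ℝ) := by
    ext j
    simp [Finset.sum_apply, Pi.single_apply]
  conv_lhs => rw [hξ]
  simp only [map_sum, map_smul, _root_.sum_apply, _root_.smul_apply,
    smul_eq_mul, hess, iteratedFDeriv_two_apply, Finset.mul_sum]
  rw [Finset.sum_comm]
  refine Finset.sum_congr rfl fun i _ => Finset.sum_congr rfl fun j _ => ?_
  simp
  ring

/-- The trace of the product of a positive semidefinite and a negative semidefinite matrix is
nonpositive. -/
lemma Matrix.PosSemidef.sum_mul_nonpos {n : Type*} [Fintype n] {S W : Matrix n n ℝ}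
    (hS : S.PosSemidef) (hW : ∀ ξ : n → ℝ, ∑ i, ∑ j, ξ i * ξ j * W i j ≤ 0) :
    ∑ i, ∑ j, S i j * W j i ≤ 0 := by
  obtain ⟨m, b, rfl⟩ := Matrix.posSemidef_iff_eq_sum_vecMulVec.1 hS
  have : ∑ i, ∑ j, (∑ k, Matrix.vecMulVec (b k) (star (b k))) i j * W j i
      = ∑ k, ∑ j, ∑ i, b k j * b k i * W j i := by
    simp only [Matrix.sum_apply, Matrix.vecMulVec_apply, star_trivial, Finset.sum_mul]
    rw [Finset.sum_comm]
    conv_rhs => rw [Finset.sum_comm]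
    refine Finset.sum_congr rfl fun j _ => ?_
    conv_rhs => rw [Finset.sum_comm]
    refine Finset.sum_congr rfl fun i _ => Finset.sum_congr rfl fun k _ => by ring
  rw [this]
  exact Finset.sum_nonpos fun k _ => hW (b k)

/-- Coercivity of a positive definite quadratic form. -/
lemma Matrix.PosDef.exists_pos_mul_norm_sq_le {d : ℕ} {a : Matrix (Fin d) (Fin d) ℝ}
    (ha : a.PosDef) :
    ∃ lam : ℝ, 0 < lam ∧ ∀ ξ : Euc d, lam * ‖ξ‖ ^ 2 ≤ ∑ i, ∑ j, ξ i * ξ j * a i j := by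
  set Q : Euc d → ℝ := fun ξ => ∑ i, ∑ j, ξ i * ξ j * a i j with hQ
  have hpos : ∀ ξ : Euc d, ξ ≠ 0 → 0 < Q ξ := by
    intro ξ hξ
    have h := ha.dotProduct_mulVec_pos (x := fun i => ξ i)
      (fun h => hξ (by ext i; exact congrFun h i))
    have hQξ : Q ξ = star (fun i => ξ i) ⬝ᵥ a.mulVec fun i => ξ i := by
      simp only [hQ, dotProduct, Matrix.mulVec, Finset.mul_sum, Pi.star_apply, star_trivial]
      exact Finset.sum_congr rfl fun i _ => Finset.sum_congr rfl fun j _ => by ring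
    rwa [hQξ]
  have hcont : Continuous Q := by fun_prop
  have hscale : ∀ (s : ℝ) (ξ : Euc d), Q (s • ξ) = s ^ 2 * Q ξ := by
    intro s ξ
    simp only [hQ, PiLp.smul_apply, smul_eq_mul, Finset.mul_sum]
    exact Finset.sum_congr rfl fun i _ => Finset.sum_congr rfl fun j _ => by ring
  obtain hemp | hne := (sphere (0 : Euc d) 1).eq_empty_or_nonempty
  · refine ⟨1, one_pos, fun ξ => ?_⟩
    have hξ : ξ = 0 := by
      by_contra h
      have : (‖ξ‖⁻¹ • ξ) ∈ sphere (0 : Euc d) 1 := by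
        simp [norm_smul, inv_mul_cancel₀ (norm_ne_zero_iff.2 h)]
      simp [hemp] at this
    simp [hξ]
  · obtain ⟨e, he, hmin⟩ := (isCompact_sphere (0 : Euc d) 1).exists_isMinOn hne hcont.continuousOn
    refine ⟨Q e, hpos e (fun h => by simp [h] at he), fun ξ => ?_⟩
    by_cases hξ : ξ = 0
    · simp [hξ]
    · have hn := norm_ne_zero_iff.2 hξ
      have hmem : (‖ξ‖⁻¹ • ξ) ∈ sphere (0 : Euc d) 1 := by
        simp [norm_smul, inv_mul_cancel₀ hn]
      have h : Q e ≤ Q (‖ξ‖⁻¹ • ξ) := hmin hmem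
      rw [hscale] at h
      have hn' : 0 < ‖ξ‖ := norm_pos_iff.2 hξ
      calc Q e * ‖ξ‖ ^ 2 ≤ ‖ξ‖⁻¹ ^ 2 * Q ξ * ‖ξ‖ ^ 2 := by gcongr
        _ = Q ξ := by field_simp

/-- If `a ≥ λ` and `W ≤ 0`, then `tr(aW) ≤ λ ⟨We, e⟩` for every unit vector `e`. -/
lemma sum_mul_le_mul_of_coercive {d : ℕ} {a W : Matrix (Fin d) (Fin d) ℝ} (haS : a.IsSymm)
    {lam : ℝ} (hlam : 0 ≤ lam)
    (hcoer : ∀ ξ : Euc d, lam * ‖ξ‖ ^ 2 ≤ ∑ i, ∑ j, ξ i * ξ j * a i j)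
    (hW : ∀ ξ : Euc d, ∑ i, ∑ j, ξ i * ξ j * W i j ≤ 0) {e : Euc d} (he : ‖e‖ = 1) :
    ∑ i, ∑ j, a i j * W j i ≤ lam * ∑ i, ∑ j, e i * e j * W i j := by
  have hS : (a - lam • Matrix.vecMulVec (fun i => e i) (fun i => e i)).PosSemidef := by
    refine Matrix.PosSemidef.of_dotProduct_mulVec_nonneg ?_ fun z => ?_
    · ext i j
      simp [Matrix.vecMulVec_apply, haS.apply i j, mul_comm (e i)]
    · have h1 := hcoer (WithLp.toLp 2 z)
      have h2 : |inner ℝ (WithLp.toLp 2 z) e| ≤ ‖WithLp.toLp 2 z‖ * ‖e‖ :=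
        abs_real_inner_le_norm _ _
      rw [he, mul_one] at h2
      have h3 : inner ℝ (WithLp.toLp 2 z) e ^ 2 ≤ ‖WithLp.toLp 2 z‖ ^ 2 :=
        sq_le_sq.2 (by simpa using h2)
      have h4 : inner ℝ (WithLp.toLp 2 z) e = ∑ i, z i * e i := by
        simp [PiLp.inner_apply, mul_comm]
      have h5 : star z ⬝ᵥ (a - lam • Matrix.vecMulVec (fun i => e i) (fun i => e i)).mulVec z
          = ∑ i, ∑ j, z i * z j * a i j - lam * (∑ i, z i * e i) ^ 2 := by
        rw [sq, Finset.sum_mul_sum]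
        simp only [dotProduct, Matrix.mulVec, Finset.mul_sum, Pi.star_apply, star_trivial,
          ← Finset.sum_sub_distrib, Matrix.sub_apply, Matrix.smul_apply, Matrix.vecMulVec_apply,
          smul_eq_mul]
        exact Finset.sum_congr rfl fun i _ => Finset.sum_congr rfl fun j _ => by ring
      rw [h5, ← h4]
      have := mul_le_mul_of_nonneg_left h3 hlam
      linarith
  have h := hS.sum_mul_nonpos (W := W) fun ξ => hW (WithLp.toLp 2 ξ)
  have h6 : ∑ i, ∑ j, (a - lam • Matrix.vecMulVec (fun i => e i) (fun i => e i)) i j * W j i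
      = ∑ i, ∑ j, a i j * W j i - lam * ∑ i, ∑ j, e i * e j * W i j := by
    rw [Finset.sum_comm (f := fun i j => e i * e j * W i j)]
    simp only [Finset.mul_sum, ← Finset.sum_sub_distrib, Matrix.sub_apply, Matrix.smul_apply,
      Matrix.vecMulVec_apply, smul_eq_mul]
    exact Finset.sum_congr rfl fun i _ => Finset.sum_congr rfl fun j _ => by ring
  linarith

lemma norm_gradient {d : ℕ} (u : Euc d → ℝ) (y : Euc d) : ‖gradient u y‖ = ‖fderiv ℝ u y‖ :=
  LinearIsometryEquiv.norm_map _ _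

lemma Torus.proj_add_intCast {d : ℕ} (y : Euc d) (k : Fin d → ℤ) :
    Torus.proj (y + WithLp.toLp 2 fun i => (k i : ℝ)) = Torus.proj y := by
  funext i
  simp [Torus.proj]

/-- Every pair of points of `ℝ^d` can be moved by lattice translations into a compact set
without increasing the distance. -/
lemma exists_isCompact_lattice_representatives (d : ℕ) :
    ∃ S : Set (Euc d × Euc d), IsCompact S ∧ ∀ x y : Euc d, ∃ z ∈ S,
      Torus.proj z.1 = Torus.proj x ∧ Torus.proj z.2 = Torus.proj y ∧
      ‖z.1 - z.2‖ ≤ ‖x - y‖ := by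
  let D : Set (Euc d) := WithLp.toLp 2 '' Set.Icc (fun _ => (-1 : ℝ)) (fun _ => 1)
  have hD : IsCompact D := isCompact_Icc.image (PiLp.continuous_toLp 2 _)
  refine ⟨(fun z : Euc d × Euc d => (z.1, z.1 + z.2)) '' (D ×ˢ D),
    (hD.prod hD).image (by fun_prop), fun x y => ?_⟩
  let k : Fin d → ℤ := fun i => -⌊x i⌋
  let m : Fin d → ℤ := fun i => -round (y i - x i)
  let x₀ : Euc d := x + WithLp.toLp 2 fun i => (k i : ℝ)
  let w : Euc d := y - x + WithLp.toLp 2 fun i => (m i : ℝ)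
  have hx₀ : ∀ i, x₀ i = Int.fract (x i) := fun i => by
    simp [x₀, k, ← sub_eq_add_neg, Int.self_sub_floor]
  have hw : ∀ i, w i = (y i - x i) - round (y i - x i) := fun i => by
    simp [w, m, ← sub_eq_add_neg]
  refine ⟨(x₀, x₀ + w), ⟨(x₀, w), ⟨?_, ?_⟩, rfl⟩, Torus.proj_add_intCast x k, ?_, ?_⟩
  · refine ⟨fun i => x₀ i, ⟨fun i => ?_, fun i => ?_⟩, rfl⟩
    · simp only [hx₀]; linarith [Int.fract_nonneg (x i)]
    · simp only [hx₀]; linarith [Int.fract_lt_one (x i)]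
  · have h : ∀ i, |w i| ≤ 1 / 2 := fun i => by rw [hw]; exact abs_sub_round _
    exact ⟨fun i => w i, ⟨fun i => by simp only; linarith [(abs_le.1 (h i)).1],
      fun i => by simp only; linarith [(abs_le.1 (h i)).2]⟩, rfl⟩
  · have : x₀ + w = y + WithLp.toLp 2 fun i => ((k i + m i : ℤ) : ℝ) := by
      ext i
      simp [x₀, w]
      ring
    simp only [this]
    exact Torus.proj_add_intCast y _
  · have : x₀ - (x₀ + w) = -w := by abel
    simp only [this, norm_neg]
    rw [norm_sub_rev, EuclideanSpace.norm_eq, EuclideanSpace.norm_eq]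
    refine Real.sqrt_le_sqrt (Finset.sum_le_sum fun i _ => ?_)
    refine pow_le_pow_left₀ (norm_nonneg _) ?_ 2
    rw [hw, Real.norm_eq_abs, Real.norm_eq_abs]
    simpa using round_le (y i - x i) 0

/-- A `C²` function on the torus has a critical point at which the Hessian is nonpositive. -/
lemma exists_fderiv_eq_zero_and_trAH_nonpos {d : ℕ} {a : Matrix (Fin d) (Fin d) ℝ}
    (ha : a.PosSemidef) {w : Torus d → ℝ} (hw : ContDiff ℝ 2 (tlift w)) :
    ∃ y, fderiv ℝ (tlift w) y = 0 ∧ trAH a (tlift w) y ≤ 0 := by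
  obtain ⟨S, hS, hrep⟩ := exists_isCompact_lattice_representatives d
  obtain ⟨z₀, hz₀, -⟩ := hrep 0 0
  obtain ⟨z, -, hz⟩ := hS.exists_isMaxOn ⟨z₀, hz₀⟩
    (hw.continuous.comp continuous_fst).continuousOn
  have hmax : ∀ y, tlift w y ≤ tlift w z.1 := fun y => by
    obtain ⟨z', hz', h1, -⟩ := hrep y y
    have h : tlift w z'.1 ≤ tlift w z.1 := hz hz'
    rwa [show tlift w z'.1 = tlift w y from congrArg w h1] at h
  refine ⟨z.1, IsLocalMax.fderiv_eq_zero (Eventually.of_forall hmax), ?_⟩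
  refine ha.sum_mul_nonpos (W := fun i j => hess (tlift w) z.1 i j) fun ξ => ?_
  have h := IsLocalMax.deriv_eq_zero_and_deriv2_nonpos
    (hw.hasDerivAt_comp_line z.1 (WithLp.toLp 2 ξ))
    (hw.hasDerivAt_fderiv_comp_line z.1 (WithLp.toLp 2 ξ) 0)
    (Eventually.of_forall fun t => by simpa using hmax _)
  simpa [fderiv_fderiv_apply_eq_sum_hess] using h.2

lemma trAH_sub {d : ℕ} (a : Matrix (Fin d) (Fin d) ℝ) {u w : Euc d → ℝ} (hu : ContDiff ℝ 2 u)
    (hw : ContDiff ℝ 2 w) (y : Euc d) :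
    trAH a (fun z => u z - w z) y = trAH a u y - trAH a w y := by
  have h : iteratedFDeriv ℝ 2 (fun z => u z - w z) y
      = iteratedFDeriv ℝ 2 u y - iteratedFDeriv ℝ 2 w y :=
    iteratedFDeriv_sub_apply hu.contDiffAt hw.contDiffAt
  simp only [trAH, hess, h, _root_.sub_apply, mul_sub, Finset.sum_sub_distrib]

/-- **Comparison of cell problems.** Ergodic constants are compared at a common gradient. -/
lemma exists_sub_le_of_trAH {d : ℕ} {a : Matrix (Fin d) (Fin d) ℝ} (ha : a.PosSemidef)
    {v w : Torus d → ℝ} (hv : ContDiff ℝ 2 (tlift v)) (hw : ContDiff ℝ 2 (tlift w)) :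
    ∃ y, gradient (tlift v) y = gradient (tlift w) y ∧
      trAH a (tlift v) y ≤ trAH a (tlift w) y := by
  have hvw : ContDiff ℝ 2 (tlift fun z => v z - w z) := hv.sub hw
  obtain ⟨y, hy, htr⟩ := exists_fderiv_eq_zero_and_trAH_nonpos ha hvw
  have h1 : fderiv ℝ (tlift fun z => v z - w z) y
      = fderiv ℝ (tlift v) y - fderiv ℝ (tlift w) y :=
    fderiv_fun_sub (hv.differentiable (by norm_num) y) (hw.differentiable (by norm_num) y)
  have h2 : trAH a (tlift fun z => v z - w z) y
      = trAH a (tlift v) y - trAH a (tlift w) y := trAH_sub a hv hw y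
  refine ⟨y, ?_, by linarith⟩
  rw [gradient, gradient, sub_eq_zero.1 (h1.symm.trans hy)]

/-- Derivative information at a maximum of `u x - u y - T (1 - exp (-k ‖x - y‖))` off the
diagonal. -/
lemma trAH_sub_le_of_isMax_doubling {d : ℕ} {a : Matrix (Fin d) (Fin d) ℝ} (haS : a.IsSymm)
    {lam : ℝ} (hlam : 0 ≤ lam)
    (hcoer : ∀ ξ : Euc d, lam * ‖ξ‖ ^ 2 ≤ ∑ i, ∑ j, ξ i * ξ j * a i j)
    {u : Euc d → ℝ} (hu : ContDiff ℝ 2 u) {T k : ℝ} (hT : 0 ≤ T) (hk : 0 ≤ k) {x y : Euc d}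
    (hxy : x ≠ y)
    (hmax : ∀ x' y', u x' - u y' - T * (1 - Real.exp (-(k * ‖x' - y'‖)))
      ≤ u x - u y - T * (1 - Real.exp (-(k * ‖x - y‖)))) :
    ‖fderiv ℝ u x‖ ≤ T * k * Real.exp (-(k * ‖x - y‖)) ∧
    ‖fderiv ℝ u y‖ ≤ T * k * Real.exp (-(k * ‖x - y‖)) ∧
    trAH a u x - trAH a u y ≤ -(4 * lam * k * (T * k * Real.exp (-(k * ‖x - y‖)))) := by
  set r := ‖x - y‖ with hr
  have hr0 : 0 < r := norm_pos_iff.2 (sub_ne_zero.2 hxy)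
  have hlin : ∀ m s : ℝ, HasDerivAt (fun t => -(k * (r + t * m))) (-(k * m)) s := by
    intro m s
    simpa using ((((hasDerivAt_id s).mul_const m).const_add r).const_mul k).fun_neg
  have hψ : ∀ (m s : ℝ), HasDerivAt (fun t => T * (1 - Real.exp (-(k * (r + t * m)))))
      (m * (T * k * Real.exp (-(k * (r + s * m))))) s := by
    intro m s
    exact (((hlin m s).exp.const_sub 1).const_mul T).congr_deriv (by ring)
  have hψ' : ∀ (m s : ℝ), HasDerivAt (fun t => m * (T * k * Real.exp (-(k * (r + t * m)))))
      (m * (T * k * (-(k * m) * Real.exp (-(k * (r + s * m)))))) s := by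
    intro m s
    exact (((hlin m s).exp.const_mul (T * k)).const_mul m).congr_deriv (by ring)
  have hmono : ∀ s s' : ℝ, s ≤ s' →
      T * (1 - Real.exp (-(k * s))) ≤ T * (1 - Real.exp (-(k * s'))) := by
    intro s s' h
    gcongr
  have hline : ∀ ξ : Euc d, fderiv ℝ u x ξ - fderiv ℝ u y ξ = 0 ∧
      fderiv ℝ (fderiv ℝ u) x ξ ξ - fderiv ℝ (fderiv ℝ u) y ξ ξ ≤ 0 := by
    intro ξ
    have h := IsLocalMax.deriv_eq_zero_and_deriv2_nonpos
      (fun t => (hu.hasDerivAt_comp_line x ξ t).sub (hu.hasDerivAt_comp_line y ξ t))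
      ((hu.hasDerivAt_fderiv_comp_line x ξ 0).sub (hu.hasDerivAt_fderiv_comp_line y ξ 0))
      (Eventually.of_forall fun t => by
        have := hmax (x + t • ξ) (y + t • ξ)
        rw [add_sub_add_right_eq_sub] at this
        simp only [Pi.sub_apply, zero_smul, add_zero]
        linarith)
    simpa using h
  have heq : fderiv ℝ u y = fderiv ℝ u x := by
    ext ξ
    linarith [(hline ξ).1]
  have hone : ∀ ξ : Euc d, fderiv ℝ u x ξ ≤ T * k * Real.exp (-(k * r)) * ‖ξ‖ := by
    intro ξ
    have h := ((hu.hasDerivAt_comp_line x ξ 0).sub (hψ ‖ξ‖ 0)).nonpos_of_forall_le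
      (fun t ht => by
        have h1 := hmax (x + t • ξ) y
        have h2 : ‖x + t • ξ - y‖ ≤ r + t * ‖ξ‖ := by
          calc ‖x + t • ξ - y‖ = ‖(x - y) + t • ξ‖ := by congr 1; abel
            _ ≤ r + t * ‖ξ‖ := (norm_add_le _ _).trans (by
              rw [norm_smul, Real.norm_eq_abs, abs_of_nonneg ht])
        have h3 := hmono _ _ h2
        simp only [Pi.sub_apply, zero_smul, zero_mul, add_zero]
        linarith)
    simp only [zero_smul, zero_mul, add_zero] at h
    linarith
  have hnorm : ‖fderiv ℝ u x‖ ≤ T * k * Real.exp (-(k * r)) := by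
    refine ContinuousLinearMap.opNorm_le_bound _ (by positivity) fun ξ => ?_
    rw [Real.norm_eq_abs, abs_le]
    have h := hone (-ξ)
    rw [map_neg, norm_neg] at h
    exact ⟨by linarith, hone ξ⟩
  refine ⟨hnorm, heq ▸ hnorm, ?_⟩
  set e : Euc d := r⁻¹ • (x - y) with he
  have hxe : x - y = r • e := by rw [he, smul_inv_smul₀ hr0.ne']
  have he1 : ‖e‖ = 1 := by
    rw [he, norm_smul, norm_inv, Real.norm_eq_abs, abs_of_pos hr0, ← hr, inv_mul_cancel₀ hr0.ne']
  have hopp : fderiv ℝ (fderiv ℝ u) x e e - fderiv ℝ (fderiv ℝ u) y e e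
      ≤ -(4 * k * (T * k * Real.exp (-(k * r)))) := by
    have hlm : IsLocalMax (((fun s : ℝ => u (x + s • e)) - fun s : ℝ => u (y + s • -e))
        - fun t : ℝ => T * (1 - Real.exp (-(k * (r + t * 2))))) 0 := by
      have hev : ∀ᶠ t : ℝ in 𝓝 0, 0 < r + t * 2 := by
        have : Tendsto (fun t : ℝ => r + t * 2) (𝓝 0) (𝓝 (r + 0 * 2)) :=
          Continuous.tendsto (by fun_prop) 0
        exact this.eventually_const_lt (by simpa using hr0)
      filter_upwards [hev] with t ht
      have h1 := hmax (x + t • e) (y + t • -e)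
      have h2 : ‖x + t • e - (y + t • -e)‖ = r + t * 2 := by
        have : x + t • e - (y + t • -e) = (r + t * 2) • e := by
          calc x + t • e - (y + t • -e) = (x - y) + (t * 2) • e := by module
            _ = (r + t * 2) • e := by rw [hxe]; module
        rw [this, norm_smul, he1, Real.norm_eq_abs, abs_of_pos ht, mul_one]
      rw [h2] at h1
      simp only [Pi.sub_apply, zero_smul, zero_mul, add_zero]
      linarith
    have h := (IsLocalMax.deriv_eq_zero_and_deriv2_nonpos
      (fun t => ((hu.hasDerivAt_comp_line x e t).sub (hu.hasDerivAt_comp_line y (-e) t)).sub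
        (hψ 2 t))
      (((hu.hasDerivAt_fderiv_comp_line x e 0).sub
        (hu.hasDerivAt_fderiv_comp_line y (-e) 0)).sub (hψ' 2 0)) hlm).2
    simp only [zero_smul, zero_mul, add_zero, map_neg, neg_neg,
      _root_.neg_apply] at h
    linarith
  have htr := sum_mul_le_mul_of_coercive (W := fun i j => hess u x i j - hess u y i j) haS hlam
    hcoer (fun ξ => by
      have := (hline ξ).2
      rw [fderiv_fderiv_apply_eq_sum_hess, fderiv_fderiv_apply_eq_sum_hess] at this
      simpa only [mul_sub, Finset.sum_sub_distrib] using this) he1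
  rw [fderiv_fderiv_apply_eq_sum_hess, fderiv_fderiv_apply_eq_sum_hess] at hopp
  simp only [mul_sub, Finset.sum_sub_distrib] at htr
  rw [← mul_sub] at htr
  have := mul_le_mul_of_nonneg_left hopp hlam
  simp only [trAH]
  linarith

/-- **A priori gradient bound** on the torus for `|tr(a D²v)| ≤ M |Dv| + N`. -/
lemma exists_gradient_bound {d : ℕ} {a : Matrix (Fin d) (Fin d) ℝ} (ha : a.PosDef)
    (haS : a.IsSymm) {M : ℝ} (hM : 0 ≤ M) :
    ∃ G : ℝ, 0 < G ∧ ∀ (N : ℝ) (v : Torus d → ℝ), 0 < N → ContDiff ℝ 2 (tlift v) →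
      (∀ y, |trAH a (tlift v) y| ≤ M * ‖gradient (tlift v) y‖ + N) →
      ∀ y, ‖gradient (tlift v) y‖ ≤ G * N := by
  obtain ⟨lam, hlam, hcoer⟩ := ha.exists_pos_mul_norm_sq_le
  obtain ⟨S, hS, hrep⟩ := exists_isCompact_lattice_representatives d
  obtain ⟨R, hR⟩ := hS.exists_bound_of_continuousOn
    (f := fun z : Euc d × Euc d => z.1 - z.2) (by fun_prop)
  set k : ℝ := (M + 1) / (2 * lam) with hkdef
  have hk : 0 < k := by positivity
  refine ⟨2 * Real.exp (k * R), by positivity, fun N v hN hv hpde y₀ => ?_⟩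
  set T : ℝ := 2 * N * Real.exp (k * R) / k with hTdef
  have hT : 0 < T := by positivity
  have hTk : T * k = 2 * N * Real.exp (k * R) := by rw [hTdef]; field_simp
  set u := tlift v with hudef
  set Φ : Euc d × Euc d → ℝ :=
    fun z => u z.1 - u z.2 - T * (1 - Real.exp (-(k * ‖z.1 - z.2‖))) with hΦ
  have hc : Continuous u := hv.continuous
  obtain ⟨z₀, hz₀, -⟩ := hrep 0 0
  obtain ⟨z, hzS, hz⟩ := hS.exists_isMaxOn ⟨z₀, hz₀⟩
    (f := Φ) (Continuous.continuousOn (by fun_prop))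
  have hmax : ∀ x y, Φ (x, y) ≤ Φ z := by
    intro x y
    obtain ⟨z', hz', h1, h2, h3⟩ := hrep x y
    refine le_trans ?_ (hz hz')
    have e1 : u z'.1 = u x := congrArg v h1
    have e2 : u z'.2 = u y := congrArg v h2
    simp only [hΦ, e1, e2]
    gcongr
  have hdiag : z.1 = z.2 := by
    by_contra hne
    obtain ⟨h1, h2, h3⟩ := trAH_sub_le_of_isMax_doubling haS hlam.le hcoer hv hT.le hk.le hne
      (fun x y => hmax x y)
    rw [hTk] at h1 h2 h3
    set P := 2 * N * Real.exp (k * R) * Real.exp (-(k * ‖z.1 - z.2‖)) with hP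
    have hP2 : 2 * N ≤ P := by
      rw [hP, mul_assoc, ← Real.exp_add]
      have : 1 ≤ Real.exp (k * R + -(k * ‖z.1 - z.2‖)) :=
        Real.one_le_exp (by nlinarith [hR z hzS])
      nlinarith
    have e1 := (abs_le.1 (hpde z.1)).1
    have e2 := (abs_le.1 (hpde z.2)).2
    rw [norm_gradient] at e1 e2
    have e3 := mul_le_mul_of_nonneg_left h1 hM
    have e4 := mul_le_mul_of_nonneg_left h2 hM
    have e5 : 4 * lam * k * P = 2 * (M + 1) * P := by rw [hkdef]; field_simp; ring
    linarith
  have hbound : ∀ x y, u x - u y ≤ T * k * ‖x - y‖ := by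
    intro x y
    have h := hmax x y
    simp only [hΦ, hdiag, sub_self, norm_zero, mul_zero, neg_zero, Real.exp_zero] at h
    have h2 := mul_le_mul_of_nonneg_left (Real.add_one_le_exp (-(k * ‖x - y‖))) hT.le
    linarith
  have hlip : LipschitzWith (T * k).toNNReal u := by
    refine LipschitzWith.of_dist_le_mul fun x y => ?_
    rw [Real.coe_toNNReal _ (by positivity), Real.dist_eq, dist_eq_norm, abs_le]
    have := hbound y x
    rw [norm_sub_rev] at this
    exact ⟨by linarith, hbound x y⟩
  have h := norm_fderiv_le_of_lipschitz ℝ hlip (x₀ := y₀)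
  rw [Real.coe_toNNReal _ (by positivity), hTk] at h
  rw [norm_gradient]
  linarith

lemma W1T_nonneg {d : ℕ} (μ ν : ProbT d) : 0 ≤ W1T μ ν :=
  Real.iInf_nonneg fun _ => integral_nonneg fun _ => dist_nonneg

/-- The Wasserstein distance on the torus is bounded. -/
lemma exists_W1T_le (d : ℕ) : ∃ D : ℝ, 0 ≤ D ∧ ∀ μ ν : ProbT d, W1T μ ν ≤ D := by
  obtain ⟨D, hD⟩ := (isCompact_univ (X := Torus d)).isBounded.exists_norm_le
  have hD0 : 0 ≤ D := (norm_nonneg _).trans (hD 0 trivial)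
  refine ⟨D + D, by positivity, fun μ ν => ?_⟩
  refine (ciInf_le ⟨0, ?_⟩ ⟨(μ : Measure (Torus d)).prod ν, inferInstance, ?_, ?_⟩).trans ?_
  · rintro _ ⟨π, rfl⟩
    exact integral_nonneg fun _ => dist_nonneg
  · have h := norm_integral_le_of_norm_le_const (μ := (μ : Measure (Torus d)).prod ν)
      (f := fun z => dist z.1 z.2) (C := D + D) (Eventually.of_forall fun z => by
        rw [Real.norm_eq_abs, abs_of_nonneg dist_nonneg]
        exact (dist_le_norm_add_norm _ _).trans (add_le_add (hD _ trivial) (hD _ trivial)))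
    rw [probReal_univ, mul_one] at h
    exact (le_abs_self _).trans h
  · simp
  · simp

/-- Continuous data that are Lipschitz in the measure are uniformly bounded. -/
lemma exists_norm_le_of_lipschitz {d n : ℕ} {F : Type*} [NormedAddCommGroup F]
    {A : Set (Euc n)} (hA : IsCompact A) {g : Torus d → Torus d → Euc n → ProbT d → F} {K : ℝ}
    (hcont : ∀ μ, Continuous fun z : Torus d × Torus d × Euc n => g z.1 z.2.1 z.2.2 μ)
    (hlip : ∀ x x' y y' α μ μ', α ∈ A →
      ‖g x y α μ - g x' y' α μ'‖ ≤ K * (dist x x' + dist y y' + W1T μ μ')) :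
    ∃ M : ℝ, 0 ≤ M ∧ ∀ x y α μ, α ∈ A → ‖g x y α μ‖ ≤ M := by
  obtain ⟨D, hD0, hD⟩ := exists_W1T_le d
  let μ₀ : ProbT d := ⟨Measure.dirac 0, inferInstance⟩
  obtain ⟨B, hB⟩ := (isCompact_univ.prod (isCompact_univ.prod hA)).exists_bound_of_continuousOn
    (hcont μ₀).continuousOn
  refine ⟨|B| + |K| * D, by positivity, fun x y α μ hα => ?_⟩
  have h1 := hlip x x y y α μ μ₀ hα
  rw [dist_self, dist_self, zero_add, zero_add] at h1
  have h2 : K * W1T μ μ₀ ≤ |K| * D :=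
    mul_le_mul (le_abs_self K) (hD μ μ₀) (W1T_nonneg _ _) (abs_nonneg K)
  have h3 : ‖g x y α μ₀‖ ≤ B := hB (x, y, α) ⟨trivial, trivial, hα⟩
  have h4 := norm_add_le (g x y α μ - g x y α μ₀) (g x y α μ₀)
  rw [sub_add_cancel] at h4
  linarith [le_abs_self B]

lemma Real.abs_sSup_image_le {ι : Type*} {A : Set ι} {φ : ι → ℝ} {B : ℝ} (hB : 0 ≤ B)
    (h : ∀ α ∈ A, |φ α| ≤ B) : |sSup (φ '' A)| ≤ B := by
  have hub : ∀ b ∈ φ '' A, b ≤ B := by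
    rintro _ ⟨α, hα, rfl⟩
    exact (abs_le.1 (h α hα)).2
  obtain rfl | ⟨α, hα⟩ := A.eq_empty_or_nonempty
  · simpa using hB
  · exact abs_le.2 ⟨(abs_le.1 (h α hα)).1.trans (le_csSup ⟨B, hub⟩ ⟨α, hα, rfl⟩),
      csSup_le ⟨_, α, hα, rfl⟩ hub⟩

/-- Bound on the ergodic constant of a Hamiltonian with linear growth. -/
lemma IsErgSol.abs_le {d : ℕ} {a : Matrix (Fin d) (Fin d) ℝ} (ha : a.PosSemidef)
    {H : Torus d → Torus d → Euc d → Euc d → ProbT d → ℝ} {x : Torus d} {p : Euc d}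
    {μ : ProbT d} {v : Torus d → ℝ} {l B : ℝ} (h : IsErgSol a H x p μ v l)
    (hB : ∀ y, |H x y p 0 μ| ≤ B) : |l| ≤ B := by
  have h0 : tlift (fun _ : Torus d => (0 : ℝ)) = fun _ => 0 := rfl
  have hc : ContDiff ℝ 2 (tlift fun _ : Torus d => (0 : ℝ)) := contDiff_const
  have hg : ∀ y, gradient (tlift fun _ : Torus d => (0 : ℝ)) y = 0 := fun y => by
    rw [h0, gradient_fun_const]
  have ht : ∀ y, trAH a (tlift fun _ : Torus d => (0 : ℝ)) y = 0 := fun y => by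
    simp [h0, trAH, hess]
  obtain ⟨y, hy, hy'⟩ := exists_sub_le_of_trAH ha h.1 hc
  obtain ⟨z, hz, hz'⟩ := exists_sub_le_of_trAH ha hc h.1
  have e1 := h.2 y
  have e2 := h.2 z
  rw [hy, hg] at e1
  rw [← hz, hg] at e2
  rw [ht] at hy' hz'
  exact _root_.abs_le.2 ⟨by linarith [(_root_.abs_le.1 (hB (Torus.proj y))).1],
    by linarith [(_root_.abs_le.1 (hB (Torus.proj z))).2]⟩

/-- Lipschitz-type regularity of the effective Hamiltonian: there is `C > 0`
such that whenever `(v, l)` solves the ergodic cell problem with data `(x, p, μ)` and `(v', l')`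
solves it with data `(x', p', μ')`, one has
`|l − l'| ≤ C (1 + |p| + |p'|)(d(x,x') + |p − p'| + d₁(μ, μ'))`. -/
theorem effective_hamiltonian_regularity (d : ℕ)
    -- `a = σ₂σ₂ᵀ + σ_{0,2}σ_{0,2}ᵀ` is a constant symmetric positive definite matrix
    (a : Matrix (Fin d) (Fin d) ℝ) (ha : a.PosDef) (haS : a.IsSymm)
    -- `A ⊂ ℝ^{2d}` is a compact set of controls
    (A : Set (Euc (2*d))) (hA : IsCompact A)
    -- the data `c, f, L`, continuous and Lipschitz in `(x,y,μ)` uniformly in `α ∈ A`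
    (c f : Torus d → Torus d → Euc (2*d) → ProbT d → Euc d)
    (L : Torus d → Torus d → Euc (2*d) → ProbT d → ℝ)
    (hccont : ∀ μ, Continuous fun z : Torus d × Torus d × Euc (2*d) => c z.1 z.2.1 z.2.2 μ)
    (hfcont : ∀ μ, Continuous fun z : Torus d × Torus d × Euc (2*d) => f z.1 z.2.1 z.2.2 μ)
    (hLcont : ∀ μ, Continuous fun z : Torus d × Torus d × Euc (2*d) => L z.1 z.2.1 z.2.2 μ)
    (K : ℝ)
    (hclip : ∀ x x' y y' α μ μ', α ∈ A →
      ‖c x y α μ - c x' y' α μ'‖ ≤ K * (dist x x' + dist y y' + W1T μ μ'))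
    (hflip : ∀ x x' y y' α μ μ', α ∈ A →
      ‖f x y α μ - f x' y' α μ'‖ ≤ K * (dist x x' + dist y y' + W1T μ μ'))
    (hLlip : ∀ x x' y y' α μ μ', α ∈ A →
      |L x y α μ - L x' y' α μ'| ≤ K * (dist x x' + dist y y' + W1T μ μ'))
    -- the Bellman Hamiltonian
    (H : Torus d → Torus d → Euc d → Euc d → ProbT d → ℝ)
    (hHdef : ∀ x y p q μ,
      H x y p q μ =
        sSup ((fun α => -⟪p, c x y α μ⟫ - ⟪q, f x y α μ⟫ - L x y α μ) '' A))
    (C_H β : ℝ) (hβ0 : 0 < β) (hβ1 : β < 1)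
    -- (A3)(2): global Lipschitz-type estimate for `H`
    (hHlip : ∀ x x' y y' p p' q q' μ μ',
      |H x y p q μ - H x' y' p' q' μ'| ≤
        C_H * (1 + ‖p‖ + ‖q‖ + ‖p'‖ + ‖q'‖) *
          (dist x x' + dist y y' + ‖p - p'‖ + ‖q - q'‖ + W1T μ μ'))
    -- (A3)(3): for each `μ`, `(x,y,p,q) ↦ H` is C²
    (hHC2 : ∀ μ, ContDiff ℝ 2
      (fun z : Euc d × Euc d × Euc d × Euc d =>
        H (Torus.proj z.1) (Torus.proj z.2.1) z.2.2.1 z.2.2.2 μ))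
    -- with second derivative locally β-Hölder continuous uniformly in `μ`
    (hHholder : ∀ R : ℝ, 0 < R → ∃ C : ℝ, ∀ μ, ∀ z z' : Euc d × Euc d × Euc d × Euc d,
      ‖z‖ ≤ R → ‖z'‖ ≤ R →
      ‖iteratedFDeriv ℝ 2 (fun w : Euc d × Euc d × Euc d × Euc d =>
          H (Torus.proj w.1) (Torus.proj w.2.1) w.2.2.1 w.2.2.2 μ) z
        - iteratedFDeriv ℝ 2 (fun w : Euc d × Euc d × Euc d × Euc d =>
          H (Torus.proj w.1) (Torus.proj w.2.1) w.2.2.1 w.2.2.2 μ) z'‖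
        ≤ C * ‖z - z'‖ ^ β)
    -- `|D_x H| ≤ C_H (1+|p|)` and `|D_p H| ≤ C_H (1+|p|)`
    (hDx : ∀ (x : Euc d) (y : Torus d) (p q : Euc d) (μ : ProbT d),
      ‖fderiv ℝ (fun x' : Euc d => H (Torus.proj x') y p q μ) x‖ ≤ C_H * (1 + ‖p‖))
    (hDp : ∀ (x y : Torus d) (p q : Euc d) (μ : ProbT d),
      ‖fderiv ℝ (fun p' : Euc d => H x y p' q μ) p‖ ≤ C_H * (1 + ‖p‖))
    :
    ∃ C : ℝ, 0 < C ∧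
      ∀ (x x' : Torus d) (p p' : Euc d) (μ μ' : ProbT d)
        (v v' : Torus d → ℝ) (l l' : ℝ),
        IsErgSol a H x p μ v l → IsErgSol a H x' p' μ' v' l' →
          |l - l'| ≤ C * (1 + ‖p‖ + ‖p'‖) * (dist x x' + ‖p - p'‖ + W1T μ μ') := by
  obtain ⟨Mc, hMc0, hMc⟩ := exists_norm_le_of_lipschitz hA hccont hclip
  obtain ⟨Mf, hMf0, hMf⟩ := exists_norm_le_of_lipschitz hA hfcont hflip
  obtain ⟨ML, hML0, hML⟩ := exists_norm_le_of_lipschitz hA hLcont hLlip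
  set M : ℝ := Mc + Mf + ML + 1 with hM
  have hM0 : 0 < M := by positivity
  have hgrowth : ∀ x y p q μ, |H x y p q μ| ≤ M * (1 + ‖p‖ + ‖q‖) := by
    intro x y p q μ
    rw [hHdef]
    refine Real.abs_sSup_image_le (by positivity) fun α hα => ?_
    have h1 : |⟪p, c x y α μ⟫| ≤ ‖p‖ * M := (abs_real_inner_le_norm _ _).trans
      (mul_le_mul_of_nonneg_left (by linarith [hMc x y α μ hα]) (norm_nonneg p))
    have h2 : |⟪q, f x y α μ⟫| ≤ ‖q‖ * M := (abs_real_inner_le_norm _ _).trans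
      (mul_le_mul_of_nonneg_left (by linarith [hMf x y α μ hα]) (norm_nonneg q))
    have h3 : |L x y α μ| ≤ M := by
      have := hML x y α μ hα
      rw [Real.norm_eq_abs] at this
      linarith
    rw [abs_le] at *
    constructor <;> linarith
  obtain ⟨G, hG0, hG⟩ := exists_gradient_bound ha haS hM0.le
  have hgrad : ∀ (x : Torus d) (p : Euc d) (μ : ProbT d) (v : Torus d → ℝ) (l : ℝ),
      IsErgSol a H x p μ v l → ∀ y, ‖gradient (tlift v) y‖ ≤ G * (2 * M * (1 + ‖p‖)) := by
    intro x p μ v l h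
    have hl : |l| ≤ M * (1 + ‖p‖) :=
      h.abs_le ha.posSemidef fun y => by simpa using hgrowth x y p 0 μ
    refine hG _ v (by positivity) h.1 fun y => ?_
    have e := h.2 y
    have hH := hgrowth x (Torus.proj y) p (gradient (tlift v) y) μ
    rw [abs_le] at *
    constructor <;> linarith
  refine ⟨|C_H| * (1 + 4 * G * M) + 1, by positivity, ?_⟩
  intro x x' p p' μ μ' v v' l l' h h'
  set δ : ℝ := dist x x' + ‖p - p'‖ + W1T μ μ' with hδ
  have hδ0 : 0 ≤ δ := by
    have := W1T_nonneg μ μ'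
    positivity
  have hdiff : ∀ y, |H x (Torus.proj y) p (gradient (tlift v) y) μ
      - H x' (Torus.proj y) p' (gradient (tlift v) y) μ'|
      ≤ (|C_H| * (1 + 4 * G * M) + 1) * (1 + ‖p‖ + ‖p'‖) * δ := by
    intro y
    set q := gradient (tlift v) y with hq
    have hqb : ‖q‖ ≤ G * (2 * M * (1 + ‖p‖)) := hgrad x p μ v l h y
    have hkey := hHlip x x' (Torus.proj y) (Torus.proj y) p p' q q μ μ'
    rw [dist_self, sub_self, norm_zero, add_zero, add_zero] at hkey
    refine hkey.trans (mul_le_mul_of_nonneg_right ?_ hδ0)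
    have h1 : 1 + ‖p‖ + ‖q‖ + ‖p'‖ + ‖q‖ ≤ (1 + 4 * G * M) * (1 + ‖p‖ + ‖p'‖) := by
      have : 0 ≤ 4 * G * M * ‖p'‖ := by positivity
      linarith
    calc C_H * (1 + ‖p‖ + ‖q‖ + ‖p'‖ + ‖q‖)
        ≤ |C_H| * ((1 + 4 * G * M) * (1 + ‖p‖ + ‖p'‖)) :=
          mul_le_mul (le_abs_self _) h1 (by positivity) (abs_nonneg _)
      _ ≤ (|C_H| * (1 + 4 * G * M) + 1) * (1 + ‖p‖ + ‖p'‖) := by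
          have : 0 ≤ 1 + ‖p‖ + ‖p'‖ := by positivity
          linarith
  obtain ⟨y, hy, hy'⟩ := exists_sub_le_of_trAH ha.posSemidef h.1 h'.1
  obtain ⟨z, hz, hz'⟩ := exists_sub_le_of_trAH ha.posSemidef h'.1 h.1
  have e1 := h.2 y
  have e2 := h'.2 y
  have e3 := h.2 z
  have e4 := h'.2 z
  rw [← hy] at e2
  rw [hz] at e4
  have d1 := (abs_le.1 (hdiff y)).1
  have d2 := (abs_le.1 (hdiff z)).2
  exact abs_le.2 ⟨by linarith, by linarith⟩
end
end

section
/- Fix δ > 0, p ∈ ℝ^d, μ ∈ P(𝕋^d), and for each x ∈ 𝕋^d let v^δ(x,·) be the unique classical (C²) solution of δv(y) − tr(a D²v(y)) + H(x, y, p, Dv(y), μ) = 0 on 𝕋^d. Then for every i ∈ {1,…,d} the partial derivative ∂_{x_i} v^δ(x, y) exists for all (x,y), is continuous in (x,y), and for each fixed x the function w(y) = ∂_{x_i} v^δ(x, y) is the unique classical (C²) solution of the linearized equation δw(y) − tr(a D²w(y)) + D_qH(x, y, p, D_y v^δ(x,y), μ)·Dw(y) = −∂_{x_i}H(x, y, p,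 D_y v^δ(x,y), μ) on 𝕋^d. Moreover the mixed second derivatives D²_{x y}v^δ and D²_{y x}v^δ exist, are continuous in (x,y), and coincide. -/
noncomputable section

open MeasureTheory Metric Filter
open scoped RealInnerProductSpace ENNReal Topology

/-- `v : 𝕋^d → ℝ` is a classical (C²) solution of the discounted cell problem
`δ v(y) - tr(a D²v(y)) + H(x, y, p, Dv(y), μ) = 0` on `𝕋^d`. -/
def IsSol {d : ℕ} (a : Matrix (Fin d) (Fin d) ℝ)
    (H : Torus d → Torus d → Euc d → Euc d → ProbT d → ℝ)
    (δ : ℝ) (x : Torus d) (p : Euc d) (μ : ProbT d) (v : Torus d → ℝ) : Prop :=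
  ContDiff ℝ 2 (tlift v) ∧
  ∀ y : Euc d,
    δ * v (Torus.proj y) - trAH a (tlift v) y
      + H x (Torus.proj y) p (gradient (tlift v) y) μ = 0

/-- The linearized equation satisfied by `∂_{x_i} v^δ(x, ·)`:
`δw − tr(a D²w) + D_qH(x, y, p, D_y v^δ(x,y), μ)·Dw = −∂_{x_i}H(x, y, p, D_y v^δ(x,y), μ)`. -/
def LinSolX {d : ℕ} (a : Matrix (Fin d) (Fin d) ℝ)
    (H : Torus d → Torus d → Euc d → Euc d → ProbT d → ℝ)
    (δ : ℝ) (p : Euc d) (μ : ProbT d) (v : Torus d → Torus d → ℝ) (i : Fin d)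
    (x : Euc d) (u : Torus d → ℝ) : Prop :=
  ContDiff ℝ 2 (tlift u) ∧
  ∀ y : Euc d,
    δ * u (Torus.proj y) - trAH a (tlift u) y
      + ⟪gradient (fun q : Euc d => H (Torus.proj x) (Torus.proj y) p q μ)
            (gradient (tlift (v (Torus.proj x))) y),
          gradient (tlift u) y⟫
      = - deriv (fun t : ℝ =>
          H (Torus.proj (x + t • (EuclideanSpace.single i 1 : Euc d))) (Torus.proj y) p
            (gradient (tlift (v (Torus.proj x))) y) μ) 0

/-! ### Functions on `ℝ^d` that factor through the torus -/

/-- A function on `ℝ^d` is torus-periodic if it factors through the projection to the torus. -/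
def TorusPeriodic {d : ℕ} {F : Type*} (u : Euc d → F) : Prop :=
  ∀ y y' : Euc d, Torus.proj y = Torus.proj y' → u y = u y'

/-- The unit cube, a compact fundamental domain of the torus. -/
def unitCube (d : ℕ) : Set (Euc d) :=
  WithLp.toLp 2 '' Set.pi Set.univ fun _ : Fin d => Set.Icc (0 : ℝ) 1

theorem isCompact_unitCube (d : ℕ) : IsCompact (unitCube d) :=
  (isCompact_univ_pi fun _ => isCompact_Icc).image (PiLp.continuous_toLp 2 _)

theorem Torus.proj_add {d : ℕ} (y z : Euc d) :
    Torus.proj (y + z) = Torus.proj y + Torus.proj z := by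
  ext i; simp [Torus.proj]

theorem Torus.exists_mem_unitCube {d : ℕ} (y : Euc d) :
    ∃ y' ∈ unitCube d, Torus.proj y = Torus.proj y' := by
  refine ⟨WithLp.toLp 2 fun i => Int.fract (y i), ⟨_, ?_, rfl⟩, ?_⟩
  · intro i _
    exact ⟨Int.fract_nonneg _, (Int.fract_lt_one _).le⟩
  · funext i
    exact (AddCircle.coe_fract _).symm

theorem Torus.isOpenQuotientMap_proj (d : ℕ) :
    IsOpenQuotientMap (Torus.proj : Euc d → Torus d) := by
  have h : IsOpenQuotientMap (Pi.map fun (_ : Fin d) (t : ℝ) => (t : AddCircle (1 : ℝ))) :=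
    IsOpenQuotientMap.piMap fun _ => QuotientAddGroup.isOpenQuotientMap_mk
  exact h.comp (PiLp.homeomorph 2 _).isOpenQuotientMap

theorem torusPeriodic_tlift {d : ℕ} (v : Torus d → ℝ) : TorusPeriodic (tlift v) :=
  fun _ _ h => congrArg v h

namespace TorusPeriodic

variable {d : ℕ} {F : Type*}

theorem comp_add {u : Euc d → F} (hu : TorusPeriodic u) (ξ : Euc d) :
    TorusPeriodic fun y => u (y + ξ) := fun y y' h =>
  hu _ _ (by rw [Torus.proj_add, Torus.proj_add, h])

theorem sub [Sub F] {u v : Euc d → F} (hu : TorusPeriodic u) (hv : TorusPeriodic v) :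
    TorusPeriodic fun y => u y - v y := fun y y' h => by
  simp only [hu y y' h, hv y y' h]

theorem fderiv [NormedAddCommGroup F] [NormedSpace ℝ F] {u : Euc d → F} (hu : TorusPeriodic u) :
    TorusPeriodic (fderiv ℝ u) := fun y y' h => by
  have h1 : u = fun z => u (z + (y' - y)) := by
    funext z
    apply hu
    rw [Torus.proj_add, sub_eq_add_neg, Torus.proj_add, ← h, ← Torus.proj_add,
      add_neg_cancel]
    simp [Torus.proj, funext_iff]
  conv_lhs => rw [h1]
  rw [fderiv_comp_add_right, add_sub_cancel]

/-- A continuous torus-periodic family with compact parameter set attains its maximum. -/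
theorem exists_forall_le {T : Type*} [TopologicalSpace T] {S : Set T} (hS : IsCompact S)
    (hne : S.Nonempty) {Φ : Euc d → T → ℝ} (hΦ : ∀ t, TorusPeriodic fun y => Φ y t)
    (hc : Continuous fun z : Euc d × T => Φ z.1 z.2) :
    ∃ y₀, ∃ t₀ ∈ S, ∀ y, ∀ t ∈ S, Φ y t ≤ Φ y₀ t₀ := by
  obtain ⟨t₁, ht₁⟩ := hne
  obtain ⟨q, hq, -⟩ := Torus.exists_mem_unitCube (0 : Euc d)
  obtain ⟨z, hz, hmax⟩ := ((isCompact_unitCube d).prod hS).exists_isMaxOn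
    ⟨(q, t₁), hq, ht₁⟩ hc.continuousOn
  refine ⟨z.1, z.2, hz.2, fun y t ht => ?_⟩
  obtain ⟨y', hy', h⟩ := Torus.exists_mem_unitCube y
  rw [show Φ y t = Φ y' t from hΦ t y y' h]
  exact hmax (show (y', t) ∈ unitCube d ×ˢ S from ⟨hy', ht⟩)

theorem exists_forall_norm_le [NormedAddCommGroup F] {u : Euc d → F} (hu : TorusPeriodic u)
    (hc : Continuous u) : ∃ y₀, ∀ y, ‖u y‖ ≤ ‖u y₀‖ := by
  obtain ⟨y₀, -, -, h⟩ := exists_forall_le (T := Unit) isCompact_univ Set.univ_nonempty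
    (Φ := fun y _ => ‖u y‖) (fun _ y y' h => by simp only [hu y y' h])
    (hc.norm.comp continuous_fst)
  exact ⟨y₀, fun y => h y () trivial⟩

end TorusPeriodic

/-! ### Second derivative test -/

theorem nonpos_of_isLocalMax_of_hasDerivAt {φ φ' : ℝ → ℝ} {t c : ℝ}
    (h : ∀ s, HasDerivAt φ (φ' s) s) (h' : HasDerivAt φ' c t) (hmax : IsLocalMax φ t) :
    c ≤ 0 := by
  by_contra! hc
  have hd : deriv φ = φ' := funext fun s => (h s).deriv
  have hmin : IsLocalMin φ t := isLocalMin_of_deriv_deriv_pos (by rw [hd, h'.deriv]; exact hc)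
    hmax.deriv_eq_zero (h t).continuousAt
  have hconst : φ =ᶠ[𝓝 t] fun _ => φ t := by
    filter_upwards [hmax, hmin] with s h1 h2 using le_antisymm h1 h2
  have h2 : φ' =ᶠ[𝓝 t] fun _ => 0 := by
    rw [← hd]
    simpa using hconst.deriv
  have := h2.deriv_eq
  rw [h'.deriv, deriv_const] at this
  exact hc.ne' this

section Line

variable {E : Type*} [NormedAddCommGroup E] [NormedSpace ℝ E]

theorem hasDerivAt_line {F : Type*} [NormedAddCommGroup F] [NormedSpace ℝ F] {u : E → F}
    (hu : Differentiable ℝ u) (y ξ : E) (t : ℝ) :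
    HasDerivAt (fun t : ℝ => u (y + t • ξ)) (fderiv ℝ u (y + t • ξ) ξ) t := by
  have h1 : HasDerivAt (fun t : ℝ => y + t • ξ) ξ t := by
    simpa using ((hasDerivAt_id t).smul_const ξ).const_add y
  exact (hu _).hasFDerivAt.comp_hasDerivAt t h1

theorem hasDerivAt_fderiv_line {u : E → ℝ} (hu : ContDiff ℝ 2 u) (y ξ : E) (t : ℝ) :
    HasDerivAt (fun t : ℝ => fderiv ℝ u (y + t • ξ) ξ)
      (fderiv ℝ (fderiv ℝ u) (y + t • ξ) ξ ξ) t := by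
  have h1 : Differentiable ℝ (fderiv ℝ u) :=
    (hu.fderiv_right (m := 1) (by norm_num)).differentiable (by norm_num)
  exact (hasDerivAt_line h1 y ξ t).clm_apply (hasDerivAt_const t ξ) |>.congr_deriv (by simp)

end Line

/-! ### Constant coefficient operators in diagonal form -/

/-- The operator `∑ₗ λₗ ∂²u/∂bₗ²`. -/
def diagOp {d : ℕ} (lam : Fin d → ℝ) (b : OrthonormalBasis (Fin d) ℝ (Euc d)) (u : Euc d → ℝ)
    (y : Euc d) : ℝ :=
  ∑ l, lam l * fderiv ℝ (fderiv ℝ u) y (b l) (b l)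

theorem ContDiff.differentiable_fderiv_of_two {E F : Type*} [NormedAddCommGroup E]
    [NormedSpace ℝ E] [NormedAddCommGroup F] [NormedSpace ℝ F] {u : E → F} (hu : ContDiff ℝ 2 u) :
    Differentiable ℝ (fderiv ℝ u) :=
  (hu.fderiv_right (m := 1) (by norm_num)).differentiable (by norm_num)

section DiagOp

variable {d : ℕ} {lam : Fin d → ℝ} {b : OrthonormalBasis (Fin d) ℝ (Euc d)}

theorem fderiv_fderiv_sub {E : Type*} [NormedAddCommGroup E] [NormedSpace ℝ E] {u v : E → ℝ}
    (hu : ContDiff ℝ 2 u) (hv : ContDiff ℝ 2 v) (y : E) :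
    fderiv ℝ (fderiv ℝ fun y => u y - v y) y =
      fderiv ℝ (fderiv ℝ u) y - fderiv ℝ (fderiv ℝ v) y := by
  have h : (fderiv ℝ fun y => u y - v y) = fun y => fderiv ℝ u y - fderiv ℝ v y := by
    funext y
    exact fderiv_fun_sub (hu.differentiable (by norm_num) y) (hv.differentiable (by norm_num) y)
  rw [h]
  exact fderiv_fun_sub (hu.differentiable_fderiv_of_two y) (hv.differentiable_fderiv_of_two y)

theorem diagOp_sub {u v : Euc d → ℝ} (hu : ContDiff ℝ 2 u) (hv : ContDiff ℝ 2 v) (y : Euc d) :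
    diagOp lam b (fun y => u y - v y) y = diagOp lam b u y - diagOp lam b v y := by
  simp only [diagOp, fderiv_fderiv_sub hu hv, ← Finset.sum_sub_distrib]
  exact Finset.sum_congr rfl fun l _ => by simp; ring

theorem diagOp_comp_add (u : Euc d → ℝ) (ξ y : Euc d) :
    diagOp lam b (fun y => u (y + ξ)) y = diagOp lam b u (y + ξ) := by
  have h : (fderiv ℝ fun y => u (y + ξ)) = fun y => fderiv ℝ u (y + ξ) := by
    funext y
    exact fderiv_comp_add_right ξ
  simp only [diagOp, h, fderiv_comp_add_right]

theorem torusPeriodic_diagOp {u : Euc d → ℝ} (hu : TorusPeriodic u) :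
    TorusPeriodic (diagOp lam b u) := fun y y' h => by
  simp only [diagOp, hu.fderiv.fderiv y y' h]

theorem norm_le_sum_apply_orthonormalBasis (b : OrthonormalBasis (Fin d) ℝ (Euc d))
    (L : Euc d →L[ℝ] ℝ) : ‖L‖ ≤ ∑ l, |L (b l)| := by
  refine L.opNorm_le_bound (Finset.sum_nonneg fun _ _ => abs_nonneg _) fun x => ?_
  conv_lhs => rw [← b.sum_repr x]
  rw [map_sum, Finset.sum_mul]
  refine (norm_sum_le _ _).trans (Finset.sum_le_sum fun l _ => ?_)
  rw [map_smul, norm_smul, mul_comm, Real.norm_eq_abs (L (b l))]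
  refine mul_le_mul_of_nonneg_left ?_ (abs_nonneg _)
  rw [b.repr_apply_apply]
  exact (norm_inner_le_norm _ _).trans (by simp [b.norm_eq_one])

/-- Maximum principle. -/
theorem le_of_forall_diagOp_le (hlam : ∀ l, 0 < lam l) {δ M g : ℝ} (hδ : 0 < δ)
    {u : Euc d → ℝ} (hu : ContDiff ℝ 2 u) (hper : TorusPeriodic u)
    (h : ∀ y, δ * u y - diagOp lam b u y ≤ M * ‖fderiv ℝ u y‖ + g) (y : Euc d) :
    u y ≤ g / δ := by
  obtain ⟨y₀, -, -, hmax⟩ := TorusPeriodic.exists_forall_le (T := Unit) isCompact_univ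
    Set.univ_nonempty (Φ := fun y _ => u y) (fun _ => hper) (hu.continuous.comp continuous_fst)
  have hloc : IsLocalMax u y₀ := Eventually.of_forall fun y => hmax y () trivial
  have hD2 : diagOp lam b u y₀ ≤ 0 := by
    refine Finset.sum_nonpos fun l _ => mul_nonpos_of_nonneg_of_nonpos (hlam l).le ?_
    have h0 : fderiv ℝ (fderiv ℝ u) (y₀ + (0 : ℝ) • b l) (b l) (b l) ≤ 0 :=
      nonpos_of_isLocalMax_of_hasDerivAt (t := 0)
        (fun s => hasDerivAt_line (hu.differentiable (by norm_num)) y₀ (b l) s)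
        (hasDerivAt_fderiv_line hu y₀ (b l) 0)
        (Eventually.of_forall fun s => by simpa using hmax _ () trivial)
    simpa using h0
  have h1 := h y₀
  rw [hloc.fderiv_eq_zero, norm_zero, mul_zero] at h1
  rw [le_div_iff₀ hδ]
  nlinarith [hmax y () trivial]

/-- Maximum principle, two-sided form. -/
theorem abs_le_of_forall_abs_diagOp_le (hlam : ∀ l, 0 < lam l) {δ M g : ℝ} (hδ : 0 < δ)
    {u : Euc d → ℝ} (hu : ContDiff ℝ 2 u) (hper : TorusPeriodic u)
    (h : ∀ y, |δ * u y - diagOp lam b u y| ≤ M * ‖fderiv ℝ u y‖ + g) (y : Euc d) :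
    |u y| ≤ g / δ := by
  refine abs_le'.2 ⟨le_of_forall_diagOp_le hlam hδ hu hper
    (fun y => (le_abs_self _).trans (h y)) y, ?_⟩
  have hz : ContDiff ℝ 2 fun _ : Euc d => (0 : ℝ) := contDiff_const
  have hD (y : Euc d) : fderiv ℝ (fun y => 0 - u y) y = - fderiv ℝ u y := by
    rw [fderiv_fun_sub (by fun_prop) (hu.differentiable (by norm_num) y)]
    simp
  have h0 (y : Euc d) : diagOp lam b (fun _ => 0) y = 0 := by simp [diagOp]
  have := le_of_forall_diagOp_le (b := b) (M := M) (g := g) hlam hδ (hz.sub hu)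
    (TorusPeriodic.sub (fun _ _ _ => rfl) hper) (fun y => by
      rw [hD, norm_neg, diagOp_sub hz hu, h0]
      refine le_trans ?_ (h y)
      rw [← abs_neg]
      refine le_trans (le_of_eq ?_) (le_abs_self _)
      ring) y
  simpa using this

/-- Directional gradient estimate: compare `u (y + t bₖ) - u (y - t bₖ)` with a concave quadratic
barrier by the maximum principle in the variables `(y, t)`. -/
theorem fderiv_apply_le_of_abs_diagOp_le (hlam : ∀ l, 0 < lam l) {U g s : ℝ} (hg : 0 < g)
    (hs : 0 < s) {u : Euc d → ℝ} (hu : ContDiff ℝ 2 u) (hper : TorusPeriodic u)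
    (hU : ∀ y, |u y| ≤ U) (hT : ∀ y, |diagOp lam b u y| ≤ g) (y : Euc d) (k : Fin d) :
    fderiv ℝ u y (b k) ≤ U / s + g * s / lam k := by
  set e := b k with he
  have hlk := hlam k
  obtain ⟨B, hB⟩ : ∃ B, B = 4 * g / lam k := ⟨_, rfl⟩
  obtain ⟨A, hA⟩ : ∃ A, A = 2 * U / s + B * s / 2 := ⟨_, rfl⟩
  have hBpos : 0 < B := by rw [hB]; positivity
  have hdiff : Differentiable ℝ u := hu.differentiable (by norm_num)
  have hAs : A * s - B * s ^ 2 / 2 = 2 * U := by rw [hA]; field_simp; ring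
  have claim : ∀ y, ∀ t ∈ Set.Icc 0 s,
      u (y + t • e) - u (y - t • e) - (A * t - B * t ^ 2 / 2) ≤ 0 := by
    obtain ⟨y₀, t₀, ht₀, hmax⟩ := TorusPeriodic.exists_forall_le (isCompact_Icc (a := 0) (b := s))
      ⟨0, by simp [hs.le]⟩
      (Φ := fun y t => u (y + t • e) - u (y - t • e) - (A * t - B * t ^ 2 / 2))
      (fun t y y' h => by
        simp only [sub_eq_add_neg y, sub_eq_add_neg y']
        rw [show u (y + _) = _ from hper.comp_add (t • e) y y' h,
          show u (y + _) = _ from hper.comp_add (-(t • e)) y y' h])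
      (by have := hu.continuous; fun_prop)
    intro y t ht
    refine (hmax y t ht).trans ?_
    by_contra! hpos
    have ht0 : t₀ ≠ 0 := by
      rintro rfl
      simp at hpos
    have hts : t₀ ≠ s := by
      rintro rfl
      rw [hAs] at hpos
      linarith [abs_le.1 (hU (y₀ + t₀ • e)), abs_le.1 (hU (y₀ - t₀ • e))]
    have htI : t₀ ∈ Set.Ioo 0 s := ⟨lt_of_le_of_ne ht₀.1 ht0.symm, lt_of_le_of_ne ht₀.2 hts⟩
    have hspace (l : Fin d) : fderiv ℝ (fderiv ℝ u) (y₀ + t₀ • e) (b l) (b l) ≤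
        fderiv ℝ (fderiv ℝ u) (y₀ - t₀ • e) (b l) (b l) := by
      have h0 := nonpos_of_isLocalMax_of_hasDerivAt (t := 0)
        (fun r => (hasDerivAt_line hdiff (y₀ + t₀ • e) (b l) r).sub
          (hasDerivAt_line hdiff (y₀ - t₀ • e) (b l) r))
        ((hasDerivAt_fderiv_line hu (y₀ + t₀ • e) (b l) 0).sub
          (hasDerivAt_fderiv_line hu (y₀ - t₀ • e) (b l) 0))
        (Eventually.of_forall fun r => by
          have := hmax (y₀ + r • b l) t₀ ht₀
          simp only [zero_smul, add_zero, Pi.sub_apply]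
          rw [add_right_comm, add_sub_right_comm] at this
          linarith)
      simpa using h0
    have htime : fderiv ℝ (fderiv ℝ u) (y₀ + t₀ • e) e e + B ≤
        fderiv ℝ (fderiv ℝ u) (y₀ - t₀ • e) e e := by
      have hq (r : ℝ) : HasDerivAt (fun t : ℝ => A * t - B * t ^ 2 / 2) (A - B * r) r := by
        have := ((hasDerivAt_id r).const_mul A).sub
          ((((hasDerivAt_id r).pow 2).const_mul B).div_const 2)
        refine this.congr_deriv ?_
        simp; ring
      have hq' (r : ℝ) : HasDerivAt (fun t : ℝ => A - B * t) (-B) r := by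
        simpa using ((hasDerivAt_id r).const_mul B).const_sub A
      have hn (r : ℝ) : HasDerivAt (fun t : ℝ => u (y₀ - t • e))
          (-(fderiv ℝ u (y₀ - r • e) e)) r := by
        simpa [sub_eq_add_neg] using hasDerivAt_line hdiff y₀ (-e) r
      have hn' (r : ℝ) : HasDerivAt (fun t : ℝ => -(fderiv ℝ u (y₀ - t • e) e))
          (fderiv ℝ (fderiv ℝ u) (y₀ - r • e) e e) r := by
        simpa [sub_eq_add_neg] using hasDerivAt_fderiv_line hu y₀ (-e) r
      have h0 := nonpos_of_isLocalMax_of_hasDerivAt (t := t₀)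
        (fun r => ((hasDerivAt_line hdiff y₀ e r).sub (hn r)).sub (hq r))
        (((hasDerivAt_fderiv_line hu y₀ e t₀).sub (hn' t₀)).sub (hq' t₀))
        (by
          filter_upwards [Ioo_mem_nhds htI.1 htI.2] with r hr
          exact hmax y₀ r ⟨hr.1.le, hr.2.le⟩)
      linarith
    have hsum : diagOp lam b u (y₀ + t₀ • e) + lam k * B ≤ diagOp lam b u (y₀ - t₀ • e) := by
      have h1 : lam k * B = ∑ l, if l = k then lam l * B else 0 := by simp
      rw [h1, diagOp, diagOp, ← Finset.sum_add_distrib]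
      refine Finset.sum_le_sum fun l _ => ?_
      split_ifs with hl
      · subst hl
        nlinarith [htime, hlam l]
      · simpa using mul_le_mul_of_nonneg_left (hspace l) (hlam l).le
    have hlB : lam k * B = 4 * g := by rw [hB]; field_simp
    linarith [abs_le.1 (hT (y₀ + t₀ • e)), abs_le.1 (hT (y₀ - t₀ • e))]
  have hderiv : HasDerivAt (fun t : ℝ => u (y + t • e) - u (y - t • e) - A * t)
      (2 * fderiv ℝ u y e - A) 0 := by
    have h1 := hasDerivAt_line hdiff y e 0
    have h2 := hasDerivAt_line hdiff y (-e) 0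
    have h3 := (h1.sub h2).sub ((hasDerivAt_id (0 : ℝ)).const_mul A)
    refine (h3.congr_deriv (by simp; ring)).congr_of_eventuallyEq ?_
    exact Eventually.of_forall fun t => by simp [sub_eq_add_neg]
  have hle : 2 * fderiv ℝ u y e - A ≤ 0 := by
    refine le_of_tendsto hderiv.tendsto_slope_zero_right ?_
    filter_upwards [Ioo_mem_nhdsGT hs] with t ht
    have h1 := claim y t ⟨ht.1.le, ht.2.le⟩
    have h2 : 0 ≤ B * t ^ 2 / 2 := by positivity
    refine mul_nonpos_of_nonneg_of_nonpos (inv_nonneg.2 ht.1.le) ?_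
    simp only [zero_add, zero_smul, add_zero, sub_zero, sub_self, mul_zero]
    linarith
  have hfin : U / s + g * s / lam k = A / 2 := by
    rw [hA, hB]; field_simp; ring
  linarith

end DiagOp

section GradientBounds

variable {d : ℕ} {lam : Fin d → ℝ} {b : OrthonormalBasis (Fin d) ℝ (Euc d)}

theorem diagOp_neg (u : Euc d → ℝ) (y : Euc d) :
    diagOp lam b (fun y => -u y) y = -diagOp lam b u y := by
  have h : (fderiv ℝ fun y => -u y) = fun y => -fderiv ℝ u y := by
    funext y
    exact fderiv_fun_neg
  simp only [diagOp, h, fderiv_fun_neg, ← Finset.sum_neg_distrib]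
  exact Finset.sum_congr rfl fun l _ => by simp

/-- Interpolation-type gradient bound. -/
theorem norm_fderiv_le_of_abs_diagOp_le (hlam : ∀ l, 0 < lam l) {U g s : ℝ} (hg : 0 < g)
    (hs : 0 < s) {u : Euc d → ℝ} (hu : ContDiff ℝ 2 u) (hper : TorusPeriodic u)
    (hU : ∀ y, |u y| ≤ U) (hT : ∀ y, |diagOp lam b u y| ≤ g) (y : Euc d) :
    ‖fderiv ℝ u y‖ ≤ d * (U / s) + s * (∑ l, (lam l)⁻¹) * g := by
  refine (norm_le_sum_apply_orthonormalBasis b _).trans ?_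
  have h1 : (d * (U / s) + s * (∑ l, (lam l)⁻¹) * g : ℝ) =
      ∑ l, (U / s + g * s / lam l) := by
    rw [Finset.sum_add_distrib, Finset.mul_sum, Finset.sum_mul]
    simp only [Finset.sum_const, Finset.card_univ, Fintype.card_fin, nsmul_eq_mul]
    congr 1
    exact Finset.sum_congr rfl fun l _ => by rw [div_eq_mul_inv]; ring
  rw [h1]
  refine Finset.sum_le_sum fun l _ => abs_le'.2
    ⟨fderiv_apply_le_of_abs_diagOp_le hlam hg hs hu hper hU hT y l, ?_⟩
  have h2 := fderiv_apply_le_of_abs_diagOp_le (u := fun y => -u y) (b := b) hlam hg hs hu.neg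
    (fun y y' h => congrArg Neg.neg (hper y y' h)) (fun y => by rw [abs_neg]; exact hU y)
    (fun y => by rw [diagOp_neg, abs_neg]; exact hT y) y l
  rwa [fderiv_fun_neg, neg_apply] at h2

/-- Interpolation-type bound on second derivatives. -/
theorem norm_fderiv_fderiv_le_of_lipschitz_diagOp (hlam : ∀ l, 0 < lam l) {U g s : ℝ}
    (hg : 0 < g) (hs : 0 < s) {u : Euc d → ℝ} (hu : ContDiff ℝ 2 u) (hper : TorusPeriodic u)
    (hU : ∀ y, ‖fderiv ℝ u y‖ ≤ U)
    (hT : ∀ y y', |diagOp lam b u y - diagOp lam b u y'| ≤ g * ‖y - y'‖) (y : Euc d) :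
    ‖fderiv ℝ (fderiv ℝ u) y‖ ≤ d * (U / s) + s * (∑ l, (lam l)⁻¹) * g := by
  have hU0 : 0 ≤ U := (norm_nonneg _).trans (hU 0)
  have hC : 0 ≤ d * (U / s) + s * (∑ l, (lam l)⁻¹) * g := by
    have : 0 ≤ ∑ l, (lam l)⁻¹ := Finset.sum_nonneg fun l _ => (inv_pos.2 (hlam l)).le
    positivity
  have hdiff : Differentiable ℝ u := hu.differentiable (by norm_num)
  refine norm_fderiv_le_of_lipschitz ℝ (C := NNReal.mk _ hC)
    (LipschitzWith.of_dist_le_mul fun x z => ?_)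
  rw [dist_eq_norm, dist_eq_norm, NNReal.coe_mk]
  obtain ⟨ξ, rfl⟩ : ∃ ξ, x = z + ξ := ⟨x - z, by abel⟩
  rw [add_sub_cancel_left]
  rcases eq_or_ne ξ 0 with rfl | hξ
  · simp
  have hξ' : 0 < ‖ξ‖ := norm_pos_iff.2 hξ
  have hshift : ContDiff ℝ 2 fun y => u (y + ξ) := hu.comp (contDiff_id.add contDiff_const)
  have h1 := norm_fderiv_le_of_abs_diagOp_le (u := fun y => u (y + ξ) - u y) (b := b)
    (U := U * ‖ξ‖) (g := g * ‖ξ‖) hlam (by positivity) hs (hshift.sub hu)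
    ((hper.comp_add ξ).sub hper)
    (fun y => by
      have := convex_univ.norm_image_sub_le_of_norm_fderiv_le (𝕜 := ℝ) (f := u)
        (fun x _ => hdiff x) (fun x _ => hU x) (Set.mem_univ y) (Set.mem_univ (y + ξ))
      simpa using this)
    (fun y => by
      rw [diagOp_sub hshift hu, diagOp_comp_add]
      simpa using hT (y + ξ) y) z
  rw [fderiv_fun_sub (hshift.differentiable (by norm_num) z) (hdiff z),
    fderiv_comp_add_right] at h1
  exact h1.trans (le_of_eq (by ring))

theorem exists_absorption {c K M : ℝ} (hc : 0 ≤ c) (hK : 0 ≤ K) (hM : 0 ≤ M) :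
    ∃ s > 0, ∃ C ≥ 0, ∀ N g : ℝ, 0 ≤ N → N ≤ c * (g / s) + s * K * (M * N + g) → N ≤ C * g := by
  have hpos : 0 < 2 * (K * M + 1) := by positivity
  refine ⟨1 / (2 * (K * M + 1)), by positivity,
    2 * (c * (2 * (K * M + 1)) + 1 / (2 * (K * M + 1)) * K), by positivity, fun N g hN h => ?_⟩
  obtain ⟨s, hs⟩ : ∃ s, s = 1 / (2 * (K * M + 1)) := ⟨_, rfl⟩
  have hs' : 2 * (K * M + 1) = s⁻¹ := by rw [hs]; simp
  have hspos : 0 < s := by rw [hs]; positivity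
  rw [← hs] at h ⊢
  rw [hs']
  rw [div_eq_mul_inv] at h
  have hKM : s * (K * M) ≤ 1 / 2 := by
    have : s * (2 * (K * M + 1)) = 1 := by rw [hs']; field_simp
    nlinarith
  nlinarith

theorem exists_norm_fderiv_le (hlam : ∀ l, 0 < lam l) {M : ℝ} (hM : 0 ≤ M) :
    ∃ C ≥ 0, ∀ (u : Euc d → ℝ) (g : ℝ), 0 < g → ContDiff ℝ 2 u → TorusPeriodic u →
      (∀ y, |u y| ≤ g) → (∀ y, |diagOp lam b u y| ≤ M * ‖fderiv ℝ u y‖ + g) →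
      ∀ y, ‖fderiv ℝ u y‖ ≤ C * g := by
  obtain ⟨s, hs, C, hC, h⟩ := exists_absorption (c := d) (K := ∑ l, (lam l)⁻¹) (by positivity)
    (Finset.sum_nonneg fun l _ => (inv_pos.2 (hlam l)).le) hM
  refine ⟨C, hC, fun u g hg hu hper hU hT y => ?_⟩
  obtain ⟨y₀, hmax⟩ := hper.fderiv.exists_forall_norm_le (hu.continuous_fderiv (by norm_num))
  refine (hmax y).trans (h _ _ (norm_nonneg _) ?_)
  exact norm_fderiv_le_of_abs_diagOp_le hlam (by positivity) hs hu hper hU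
    (fun y => (hT y).trans (by gcongr; exact hmax y)) y₀

theorem exists_norm_fderiv_fderiv_le (hlam : ∀ l, 0 < lam l) {M : ℝ} (hM : 0 ≤ M) :
    ∃ C ≥ 0, ∀ (u : Euc d → ℝ) (g : ℝ), 0 < g → ContDiff ℝ 2 u → TorusPeriodic u →
      (∀ y, ‖fderiv ℝ u y‖ ≤ g) → Differentiable ℝ (diagOp lam b u) →
      (∀ y, ‖fderiv ℝ (diagOp lam b u) y‖ ≤ M * ‖fderiv ℝ (fderiv ℝ u) y‖ + g) →
      ∀ y, ‖fderiv ℝ (fderiv ℝ u) y‖ ≤ C * g := by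
  obtain ⟨s, hs, C, hC, h⟩ := exists_absorption (c := d) (K := ∑ l, (lam l)⁻¹) (by positivity)
    (Finset.sum_nonneg fun l _ => (inv_pos.2 (hlam l)).le) hM
  refine ⟨C, hC, fun u g hg hu hper hU hdiff hT y => ?_⟩
  obtain ⟨y₀, hmax⟩ := hper.fderiv.fderiv.exists_forall_norm_le
    ((hu.fderiv_right (m := 1) (by norm_num)).continuous_fderiv (by norm_num))
  refine (hmax y).trans (h _ _ (norm_nonneg _) ?_)
  refine norm_fderiv_fderiv_le_of_lipschitz_diagOp (b := b) hlam (by positivity) hs hu hper hU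
    (fun y y' => ?_) y₀
  exact convex_univ.norm_image_sub_le_of_norm_fderiv_le (𝕜 := ℝ) (fun x _ => hdiff x)
    (fun x _ => (hT x).trans (by gcongr; exact hmax x)) (Set.mem_univ y') (Set.mem_univ y)

/-- A priori `C¹` estimate for linear inequalities on the torus; by periodicity it suffices to
check the inequality on the unit cube. -/
theorem exists_c1_bound (hlam : ∀ l, 0 < lam l) {δ M : ℝ} (hδ : 0 < δ) (hM : 0 ≤ M) :
    ∃ C > 0, ∀ (u : Euc d → ℝ) (g : ℝ), 0 < g → ContDiff ℝ 2 u → TorusPeriodic u →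
      (∀ y ∈ unitCube d, |δ * u y - diagOp lam b u y| ≤ M * ‖fderiv ℝ u y‖ + g) →
      ∀ y, |u y| ≤ C * g ∧ ‖fderiv ℝ u y‖ ≤ C * g := by
  obtain ⟨C, hC, h⟩ := exists_norm_fderiv_le (b := b) hlam hM
  refine ⟨(C + 1) * (1 / δ + 2), by positivity, fun u g hg hu hper hQ y => ?_⟩
  have hall (y : Euc d) : |δ * u y - diagOp lam b u y| ≤ M * ‖fderiv ℝ u y‖ + g := by
    obtain ⟨y', hy', hyy⟩ := Torus.exists_mem_unitCube y
    rw [hper y y' hyy, torusPeriodic_diagOp hper y y' hyy, hper.fderiv y y' hyy]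
    exact hQ y' hy'
  have hu0 := abs_le_of_forall_abs_diagOp_le hlam hδ hu hper hall
  have hg' : g / δ ≤ (1 / δ + 2) * g := by
    rw [add_mul, one_div, inv_mul_eq_div]; linarith
  have hpos : 0 < (1 / δ + 2) * g := by positivity
  refine ⟨(hu0 y).trans ?_, (h u ((1 / δ + 2) * g) hpos hu hper
    (fun y => (hu0 y).trans hg') (fun y => ?_) y).trans ?_⟩
  · nlinarith
  · have h1 := hall y
    have h2 : |δ * u y| ≤ g := by
      rw [abs_mul, abs_of_pos hδ, mul_comm]
      exact (le_div_iff₀ hδ).1 (hu0 y)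
    have h3 : 2 * g ≤ (1 / δ + 2) * g := by
      have : 0 ≤ 1 / δ * g := by positivity
      linarith
    rw [abs_le] at *
    constructor <;> linarith
  · nlinarith

/-- A priori `C²` estimate on the torus; by periodicity it suffices to check the
inequality on the unit cube. -/
theorem exists_c2_bound (hlam : ∀ l, 0 < lam l) {M : ℝ} (hM : 0 ≤ M) :
    ∃ C > 0, ∀ (u : Euc d → ℝ) (g : ℝ), 0 < g → ContDiff ℝ 2 u → TorusPeriodic u →
      (∀ y, ‖fderiv ℝ u y‖ ≤ g) → Differentiable ℝ (diagOp lam b u) →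
      (∀ y ∈ unitCube d,
        ‖fderiv ℝ (diagOp lam b u) y‖ ≤ M * ‖fderiv ℝ (fderiv ℝ u) y‖ + g) →
      ∀ y, ‖fderiv ℝ (fderiv ℝ u) y‖ ≤ C * g := by
  obtain ⟨C, hC, h⟩ := exists_norm_fderiv_fderiv_le (b := b) hlam hM
  refine ⟨C + 1, by positivity, fun u g hg hu hper hU hdiff hQ y => ?_⟩
  refine (h u g hg hu hper hU hdiff (fun y => ?_) y).trans (by nlinarith)
  obtain ⟨y', hy', hyy⟩ := Torus.exists_mem_unitCube y
  rw [(torusPeriodic_diagOp hper).fderiv y y' hyy, hper.fderiv.fderiv y y' hyy]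
  exact hQ y' hy'

end GradientBounds

/-! ### Uniform continuity and differentiability near compact sets -/

section Uniform

variable {E F : Type*} [NormedAddCommGroup E] [NormedAddCommGroup F]

theorem IsCompact.exists_forall_norm_add_sub_le {Φ : E → F} (hΦ : Continuous Φ) {K : Set E}
    (hK : IsCompact K) {ε : ℝ} (hε : 0 < ε) :
    ∃ η > 0, ∀ z ∈ K, ∀ k, ‖k‖ < η → ‖Φ (z + k) - Φ z‖ ≤ ε := by
  have h := hK.uniformContinuousAt_of_continuousAt Φ (fun a _ => hΦ.continuousAt)
    (dist_mem_uniformity hε)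
  obtain ⟨η, hη, h⟩ := Metric.mem_uniformity_dist.1 h
  refine ⟨η, hη, fun z hz k hk => ?_⟩
  have h1 := h (a := z) (b := z + k) (by simpa [dist_eq_norm] using hk) hz
  rw [← dist_eq_norm, dist_comm]
  exact le_of_lt h1

theorem IsCompact.exists_forall_norm_add_sub_sub_fderiv_le [NormedSpace ℝ E] [NormedSpace ℝ F]
    {Φ : E → F} (hΦ : ContDiff ℝ 1 Φ) {K : Set E} (hK : IsCompact K) {ε : ℝ} (hε : 0 < ε) :
    ∃ η > 0, ∀ z ∈ K, ∀ k, ‖k‖ < η → ‖Φ (z + k) - Φ z - fderiv ℝ Φ z k‖ ≤ ε * ‖k‖ := by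
  obtain ⟨η, hη, h⟩ := hK.exists_forall_norm_add_sub_le (hΦ.continuous_fderiv one_ne_zero) hε
  refine ⟨η, hη, fun z hz k hk => ?_⟩
  have h1 := (convex_ball z η).norm_image_sub_le_of_norm_fderiv_le' (𝕜 := ℝ) (f := Φ)
    (x := z) (y := z + k) (φ := fderiv ℝ Φ z) (C := ε)
    (fun x _ => hΦ.differentiable one_ne_zero x)
    (fun x hx => by
      have h2 := h z hz (x - z) (by rwa [mem_ball_iff_norm] at hx)
      rwa [add_sub_cancel] at h2)
    (mem_ball_self hη) (by simpa [mem_ball_iff_norm] using hk)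
  rwa [add_sub_cancel_left] at h1

end Uniform

/-! ### Families of solutions depending on a parameter -/

/-- `V x` solves `δ V - ∑ₗ λₗ ∂²V/∂bₗ² + G(x, y, DV) = 0` on the torus for every `x`, with a
Hamiltonian `G` of class `C²` that is Lipschitz in the parameter and in the gradient. -/
structure IsSolutionFamily {d : ℕ} (lam : Fin d → ℝ) (b : OrthonormalBasis (Fin d) ℝ (Euc d))
    (δ K : ℝ) (G : Euc d × Euc d × (Euc d →L[ℝ] ℝ) → ℝ) (V : Euc d → Euc d → ℝ) : Prop where
  lam_pos : ∀ l, 0 < lam l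
  discount_pos : 0 < δ
  lip_pos : 0 < K
  contDiff_ham : ContDiff ℝ 2 G
  lipschitz : ∀ x x' y l l', |G (x, y, l) - G (x', y, l')| ≤ K * (‖x - x'‖ + ‖l - l'‖)
  contDiff : ∀ x, ContDiff ℝ 2 (V x)
  periodic : ∀ x, TorusPeriodic (V x)
  equation : ∀ x y, δ * V x y - diagOp lam b (V x) y + G (x, y, fderiv ℝ (V x) y) = 0

/-- The point `(x, y, D_y V(x, y))` at which the Hamiltonian is evaluated. -/
def jet {d : ℕ} (V : Euc d → Euc d → ℝ) (x y : Euc d) : Euc d × Euc d × (Euc d →L[ℝ] ℝ) :=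
  (x, y, fderiv ℝ (V x) y)

/-- The difference quotient of `V` in the parameter direction `e`. -/
def paramQuot {d : ℕ} (V : Euc d → Euc d → ℝ) (x e : Euc d) (h : ℝ) (y : Euc d) : ℝ :=
  h⁻¹ * (V (x + h • e) y - V x y)

namespace IsSolutionFamily

variable {d : ℕ} {lam : Fin d → ℝ} {b : OrthonormalBasis (Fin d) ℝ (Euc d)} {δ K : ℝ}
  {G : Euc d × Euc d × (Euc d →L[ℝ] ℝ) → ℝ} {V : Euc d → Euc d → ℝ}

theorem differentiable (hV : IsSolutionFamily lam b δ K G V) (x : Euc d) :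
    Differentiable ℝ (V x) := (hV.contDiff x).differentiable (by norm_num)

theorem continuous_jet (hV : IsSolutionFamily lam b δ K G V) (x : Euc d) :
    Continuous (jet V x) :=
  continuous_const.prodMk (continuous_id.prodMk ((hV.contDiff x).continuous_fderiv (by norm_num)))

theorem exists_lipschitz (hV : IsSolutionFamily lam b δ K G V) :
    ∃ C > 0, ∀ x x' y, |V x' y - V x y| ≤ C * ‖x' - x‖ ∧
      ‖fderiv ℝ (V x') y - fderiv ℝ (V x) y‖ ≤ C * ‖x' - x‖ := by
  obtain ⟨C, hC, h⟩ := exists_c1_bound (b := b) hV.lam_pos hV.discount_pos hV.lip_pos.le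
  have hK := hV.lip_pos
  refine ⟨C * K, by positivity, fun x x' y => ?_⟩
  rcases eq_or_ne x' x with rfl | hx
  · simp
  have hx' : 0 < ‖x' - x‖ := norm_pos_iff.2 (sub_ne_zero.2 hx)
  have h1 := h (fun y => V x' y - V x y) (K * ‖x' - x‖) (by positivity)
    ((hV.contDiff x').sub (hV.contDiff x)) ((hV.periodic x').sub (hV.periodic x))
    (fun y _ => by
      rw [diagOp_sub (hV.contDiff x') (hV.contDiff x),
        fderiv_fun_sub (hV.differentiable x' y) (hV.differentiable x y)]
      have e1 := hV.equation x y
      have e2 := hV.equation x' y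
      have e3 := hV.lipschitz x x' y (fderiv ℝ (V x) y) (fderiv ℝ (V x') y)
      rw [norm_sub_rev x x', norm_sub_rev (fderiv ℝ (V x) y)] at e3
      rw [← mul_add, add_comm ‖_ - fderiv ℝ (V x) y‖]
      refine le_trans (le_of_eq ?_) e3
      congr 1
      linarith) y
  rw [fderiv_fun_sub (hV.differentiable x' y) (hV.differentiable x y), ← mul_assoc] at h1
  exact h1

theorem abs_fderiv_ham_apply_le (hV : IsSolutionFamily lam b δ K G V)
    (z : Euc d × Euc d × (Euc d →L[ℝ] ℝ)) (l : Euc d →L[ℝ] ℝ) :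
    |fderiv ℝ G z (0, 0, l)| ≤ K * ‖l‖ := by
  obtain ⟨x, y, q⟩ := z
  have h1 : HasFDerivAt (fun q : Euc d →L[ℝ] ℝ => ((x, y, q) : Euc d × Euc d × (Euc d →L[ℝ] ℝ)))
      ((0 : (Euc d →L[ℝ] ℝ) →L[ℝ] Euc d).prod
        ((0 : (Euc d →L[ℝ] ℝ) →L[ℝ] Euc d).prod (ContinuousLinearMap.id ℝ _))) q :=
    (hasFDerivAt_const x q).prodMk ((hasFDerivAt_const y q).prodMk (hasFDerivAt_id q))
  have h2 := ((hV.contDiff_ham.differentiable (by norm_num) (x, y, q)).hasFDerivAt.comp q h1)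
  have h3 := h2.le_of_lipschitz (C := NNReal.mk K hV.lip_pos.le)
    (LipschitzWith.of_dist_le_mul fun q q' => by
      have := hV.lipschitz x x y q q'
      rw [sub_self, norm_zero, zero_add] at this
      rw [dist_eq_norm, dist_eq_norm]
      exact this)
  exact ContinuousLinearMap.le_of_opNorm_le _ h3 l

section ParamQuot

variable (x e : Euc d)

theorem contDiff_paramQuot (hV : IsSolutionFamily lam b δ K G V) (h : ℝ) :
    ContDiff ℝ 2 (paramQuot V x e h) :=
  contDiff_const.mul ((hV.contDiff _).sub (hV.contDiff _))

theorem torusPeriodic_paramQuot (hV : IsSolutionFamily lam b δ K G V) (h : ℝ) :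
    TorusPeriodic (paramQuot V x e h) := fun y y' hy => by
  simp only [paramQuot, hV.periodic _ y y' hy]

theorem fderiv_paramQuot (hV : IsSolutionFamily lam b δ K G V) (h : ℝ) (y : Euc d) :
    fderiv ℝ (paramQuot V x e h) y =
      h⁻¹ • (fderiv ℝ (V (x + h • e)) y - fderiv ℝ (V x) y) := by
  rw [← fderiv_fun_sub (hV.differentiable _ y) (hV.differentiable _ y)]
  exact fderiv_const_mul ((hV.differentiable _ y).sub (hV.differentiable _ y)) _

theorem fderiv_fderiv_paramQuot (hV : IsSolutionFamily lam b δ K G V) (h : ℝ) (y : Euc d) :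
    fderiv ℝ (fderiv ℝ (paramQuot V x e h)) y =
      h⁻¹ • (fderiv ℝ (fderiv ℝ (V (x + h • e))) y - fderiv ℝ (fderiv ℝ (V x)) y) := by
  rw [funext (hV.fderiv_paramQuot x e h)]
  have h1 := (hV.contDiff (x + h • e)).differentiable_fderiv_of_two y
  have h2 := (hV.contDiff x).differentiable_fderiv_of_two y
  rw [← fderiv_fun_sub h1 h2]
  exact fderiv_fun_const_smul (h1.fun_sub h2) _

theorem diagOp_paramQuot (hV : IsSolutionFamily lam b δ K G V) (h : ℝ) (y : Euc d) :
    diagOp lam b (paramQuot V x e h) y =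
      δ * paramQuot V x e h y + h⁻¹ * (G (jet V (x + h • e) y) - G (jet V x y)) := by
  have h1 : diagOp lam b (paramQuot V x e h) y =
      h⁻¹ * (diagOp lam b (V (x + h • e)) y - diagOp lam b (V x) y) := by
    simp only [diagOp, hV.fderiv_fderiv_paramQuot, ← Finset.sum_sub_distrib, Finset.mul_sum]
    exact Finset.sum_congr rfl fun l _ => by simp; ring
  have e1 := hV.equation x y
  have e2 := hV.equation (x + h • e) y
  rw [h1, paramQuot, jet, jet, mul_left_comm, ← mul_add]
  congr 1
  linarith

theorem jet_add_smul (hV : IsSolutionFamily lam b δ K G V) {h : ℝ} (hh : h ≠ 0) (y : Euc d) :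
    jet V (x + h • e) y = jet V x y + h • (e, 0, fderiv ℝ (paramQuot V x e h) y) := by
  simp [jet, hV.fderiv_paramQuot, smul_smul, hh]

theorem exists_paramQuot_bound (hV : IsSolutionFamily lam b δ K G V) :
    ∃ C > 0, ∀ h : ℝ, h ≠ 0 → ∀ y, ‖fderiv ℝ (paramQuot V x e h) y‖ ≤ C ∧
      ‖((e, 0, fderiv ℝ (paramQuot V x e h) y) : Euc d × Euc d × (Euc d →L[ℝ] ℝ))‖ ≤ C := by
  obtain ⟨C, hC, hlip⟩ := hV.exists_lipschitz
  refine ⟨(C + 1) * (‖e‖ + 1), by positivity, fun h hh y => ?_⟩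
  have h2 : ‖fderiv ℝ (paramQuot V x e h) y‖ ≤ C * ‖e‖ := by
    have h1 := (hlip x (x + h • e) y).2
    rw [add_sub_cancel_left, norm_smul, mul_left_comm] at h1
    rw [hV.fderiv_paramQuot, norm_smul, norm_inv]
    exact (inv_mul_le_iff₀ (norm_pos_iff.2 hh)).2 h1
  have h3 : C * ‖e‖ ≤ (C + 1) * (‖e‖ + 1) := by nlinarith [norm_nonneg e]
  refine ⟨h2.trans h3, ?_⟩
  simp only [Prod.norm_def, norm_zero]
  refine max_le ?_ (max_le (by positivity) (h2.trans h3))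
  nlinarith [norm_nonneg e]

theorem eventually_norm_quot_sub_fderiv_le (hV : IsSolutionFamily lam b δ K G V) {F : Type*}
    [NormedAddCommGroup F] [NormedSpace ℝ F] {Φ : Euc d × Euc d × (Euc d →L[ℝ] ℝ) → F}
    (hΦ : ContDiff ℝ 1 Φ) {ε : ℝ} (hε : 0 < ε) :
    ∀ᶠ h : ℝ in 𝓝[≠] 0, ∀ y ∈ unitCube d,
      ‖h⁻¹ • (Φ (jet V (x + h • e) y) - Φ (jet V x y)) -
        fderiv ℝ Φ (jet V x y) (e, 0, fderiv ℝ (paramQuot V x e h) y)‖ ≤ ε := by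
  obtain ⟨C, hC, hb⟩ := hV.exists_paramQuot_bound x e
  obtain ⟨η, hη, hd⟩ := ((isCompact_unitCube d).image (hV.continuous_jet x)
    ).exists_forall_norm_add_sub_sub_fderiv_le hΦ (show 0 < ε / C by positivity)
  have hev : ∀ᶠ h : ℝ in 𝓝[≠] 0, ‖h‖ < η / C :=
    nhdsWithin_le_nhds (by
      filter_upwards [Metric.ball_mem_nhds (0 : ℝ) (show 0 < η / C by positivity)] with h hh
      simpa using hh)
  filter_upwards [hev, self_mem_nhdsWithin] with h hh hh0 y hy
  have hh0 : h ≠ 0 := hh0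
  have hpos : 0 < ‖h‖ := norm_pos_iff.2 hh0
  have h1 := (hb h hh0 y).2
  rw [hV.jet_add_smul x e hh0]
  generalize ((e, 0, fderiv ℝ (paramQuot V x e h) y) : Euc d × Euc d × (Euc d →L[ℝ] ℝ)) = ξ at *
  have h2 := hd (jet V x y) (Set.mem_image_of_mem _ hy) (h • ξ) (by
    rw [norm_smul]
    calc ‖h‖ * ‖ξ‖ ≤ ‖h‖ * C := by gcongr
      _ < η := by rwa [lt_div_iff₀ hC] at hh)
  have h3 : h⁻¹ • (Φ (jet V x y + h • ξ) - Φ (jet V x y)) - fderiv ℝ Φ (jet V x y) ξ =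
      h⁻¹ • (Φ (jet V x y + h • ξ) - Φ (jet V x y) - fderiv ℝ Φ (jet V x y) (h • ξ)) := by
    rw [map_smul, smul_sub h⁻¹ (_ - _), smul_smul, inv_mul_cancel₀ hh0, one_smul]
  rw [h3, norm_smul, norm_inv, inv_mul_le_iff₀ hpos]
  refine h2.trans ?_
  rw [norm_smul]
  calc ε / C * (‖h‖ * ‖ξ‖) ≤ ε / C * (‖h‖ * C) := by gcongr
    _ = ‖h‖ * ε := by field_simp

theorem eventually_paramQuot_sub_le (hV : IsSolutionFamily lam b δ K G V) {ε : ℝ} (hε : 0 < ε) :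
    ∀ᶠ p : ℝ × ℝ in 𝓝[≠] 0 ×ˢ 𝓝[≠] 0, ∀ y,
      |paramQuot V x e p.1 y - paramQuot V x e p.2 y| ≤ ε ∧
      ‖fderiv ℝ (paramQuot V x e p.1) y - fderiv ℝ (paramQuot V x e p.2) y‖ ≤ ε := by
  obtain ⟨C, hC, hb⟩ := exists_c1_bound (b := b) hV.lam_pos hV.discount_pos hV.lip_pos.le
  have hg : 0 < ε / C / 2 := by positivity
  have hev := hV.eventually_norm_quot_sub_fderiv_le x e
    (hV.contDiff_ham.of_le (by norm_num)) hg
  filter_upwards [hev.prod_mk hev] with p ⟨h1, h2⟩ y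
  have hd (h : ℝ) (y) : DifferentiableAt ℝ (paramQuot V x e h) y :=
    (hV.contDiff_paramQuot x e h).differentiable (by norm_num) y
  have h3 := hb (fun y => paramQuot V x e p.1 y - paramQuot V x e p.2 y) (ε / C) (by positivity)
    ((hV.contDiff_paramQuot x e _).sub (hV.contDiff_paramQuot x e _))
    ((hV.torusPeriodic_paramQuot x e _).sub (hV.torusPeriodic_paramQuot x e _))
    (fun y hy => by
      rw [diagOp_sub (hV.contDiff_paramQuot x e _) (hV.contDiff_paramQuot x e _),
        fderiv_fun_sub (hd _ y) (hd _ y), hV.diagOp_paramQuot, hV.diagOp_paramQuot]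
      have a1 := h1 y hy
      have a2 := h2 y hy
      have a3 := hV.abs_fderiv_ham_apply_le (jet V x y)
        (fderiv ℝ (paramQuot V x e p.1) y - fderiv ℝ (paramQuot V x e p.2) y)
      have a4 : ((0, 0, fderiv ℝ (paramQuot V x e p.1) y - fderiv ℝ (paramQuot V x e p.2) y) :
          Euc d × Euc d × (Euc d →L[ℝ] ℝ)) =
          (e, 0, fderiv ℝ (paramQuot V x e p.1) y) - (e, 0, fderiv ℝ (paramQuot V x e p.2) y) := by
        simp
      rw [a4, map_sub] at a3
      rw [Real.norm_eq_abs, smul_eq_mul, abs_le] at a1 a2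
      rw [abs_le] at a3 ⊢
      constructor <;> linarith) y
  rw [fderiv_fun_sub (hd _ y) (hd _ y), mul_div_cancel₀ _ hC.ne'] at h3
  exact h3

end ParamQuot

end IsSolutionFamily

theorem norm_le_add_of_norm_sub_le {F : Type*} [NormedAddCommGroup F] {u v : F} {r s : ℝ}
    (h₁ : ‖u - v‖ ≤ r) (h₂ : ‖v‖ ≤ s) : ‖u‖ ≤ r + s :=
  (norm_le_norm_sub_add u v).trans (add_le_add h₁ h₂)

theorem norm_sub_le_add_of_norm_sub_le {F : Type*} [NormedAddCommGroup F] {u v w : F} {r s : ℝ}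
    (h₁ : ‖u - w‖ ≤ r) (h₂ : ‖v - w‖ ≤ s) : ‖u - v‖ ≤ r + s := by
  rw [← sub_sub_sub_cancel_right u v w]
  exact norm_sub_le_of_le h₁ h₂

theorem norm_sub_le_add_add_of_norm_sub_le {F : Type*} [NormedAddCommGroup F] {u u' v v' : F}
    {r s t : ℝ} (h₁ : ‖u - u'‖ ≤ r) (h₂ : ‖v - v'‖ ≤ t) (h : ‖u' - v'‖ ≤ s) :
    ‖u - v‖ ≤ r + s + t :=
  norm_sub_le_add_of_norm_sub_le (w := v')
    (norm_le_add_of_norm_sub_le (v := u' - v') (by rwa [sub_sub_sub_cancel_right]) h) h₂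

theorem IsCompact.exists_forall_norm_fderiv_apply_le {E F : Type*} [NormedAddCommGroup E]
    [NormedAddCommGroup F] [NormedSpace ℝ E] [NormedSpace ℝ F] {Φ : E → F} (hΦ : ContDiff ℝ 1 Φ)
    {K : Set E} (hK : IsCompact K) :
    ∃ C, ∀ z ∈ K, ∀ ξ, ‖fderiv ℝ Φ z ξ‖ ≤ C * ‖ξ‖ := by
  obtain ⟨C, h⟩ := hK.exists_bound_of_continuousOn
    (hΦ.continuous_fderiv one_ne_zero).continuousOn
  exact ⟨C, fun z hz ξ => ContinuousLinearMap.le_of_opNorm_le _ (h z hz) ξ⟩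

namespace IsSolutionFamily

variable {d : ℕ} {lam : Fin d → ℝ} {b : OrthonormalBasis (Fin d) ℝ (Euc d)} {δ K : ℝ}
  {G : Euc d × Euc d × (Euc d →L[ℝ] ℝ) → ℝ} {V : Euc d → Euc d → ℝ}

theorem contDiff_fderiv_ham (hV : IsSolutionFamily lam b δ K G V) : ContDiff ℝ 1 (fderiv ℝ G) :=
  hV.contDiff_ham.fderiv_right (by norm_num)

theorem contDiff_jet (hV : IsSolutionFamily lam b δ K G V) (x : Euc d) :
    ContDiff ℝ 1 (jet V x) :=
  contDiff_const.prodMk (contDiff_id.prodMk ((hV.contDiff x).fderiv_right (by norm_num)))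

theorem fderiv_jet_apply (hV : IsSolutionFamily lam b δ K G V) (x y ξ : Euc d) :
    fderiv ℝ (jet V x) y ξ = (0, ξ, fderiv ℝ (fderiv ℝ (V x)) y ξ) := by
  have h : HasFDerivAt (jet V x) _ y := (hasFDerivAt_const x y).prodMk ((hasFDerivAt_id y).prodMk
    ((hV.contDiff x).differentiable_fderiv_of_two y).hasFDerivAt)
  rw [h.fderiv]
  rfl

theorem exists_forall_norm_comp_jet_sub_le (hV : IsSolutionFamily lam b δ K G V) {F : Type*}
    [NormedAddCommGroup F] {Φ : Euc d × Euc d × (Euc d →L[ℝ] ℝ) → F} (hΦ : Continuous Φ)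
    (x : Euc d) {ε : ℝ} (hε : 0 < ε) :
    ∀ᶠ x' in 𝓝 x, ∀ y ∈ unitCube d, ‖Φ (jet V x' y) - Φ (jet V x y)‖ ≤ ε := by
  obtain ⟨C, hC, hlip⟩ := hV.exists_lipschitz
  obtain ⟨η, hη, h⟩ := ((isCompact_unitCube d).image (hV.continuous_jet x)
    ).exists_forall_norm_add_sub_le hΦ hε
  filter_upwards [Metric.ball_mem_nhds x (show 0 < η / (C + 1) by positivity)] with x' hx' y hy
  rw [mem_ball_iff_norm, lt_div_iff₀ (by positivity)] at hx'
  have h1 := h (jet V x y) (Set.mem_image_of_mem _ hy) (jet V x' y - jet V x y) (by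
    refine lt_of_le_of_lt ?_ hx'
    simp only [jet, Prod.mk_sub_mk, sub_self, Prod.norm_def, norm_zero]
    have h2 := (hlip x x' y).2
    have h3 := norm_nonneg (x' - x)
    refine max_le ?_ (max_le (by positivity) ?_) <;> nlinarith)
  rwa [add_sub_cancel] at h1

section ParamQuot

variable (x e : Euc d)

theorem hasFDerivAt_diagOp_paramQuot (hV : IsSolutionFamily lam b δ K G V) (h : ℝ) (y : Euc d) :
    HasFDerivAt (diagOp lam b (paramQuot V x e h))
      (δ • fderiv ℝ (paramQuot V x e h) y +
        h⁻¹ • ((fderiv ℝ G (jet V (x + h • e) y)).comp (fderiv ℝ (jet V (x + h • e)) y) -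
          (fderiv ℝ G (jet V x y)).comp (fderiv ℝ (jet V x) y))) y := by
  rw [funext (hV.diagOp_paramQuot x e h)]
  have hG := hV.contDiff_ham.differentiable (by norm_num)
  have hj (x : Euc d) := ((hV.contDiff_jet x).differentiable one_ne_zero y).hasFDerivAt
  have hq := ((hV.contDiff_paramQuot x e h).differentiable (by norm_num) y).hasFDerivAt
  exact (hq.const_mul δ).add ((((hG _).hasFDerivAt.comp y (hj (x + h • e))).sub
    ((hG _).hasFDerivAt.comp y (hj x))).const_mul h⁻¹)

theorem fderiv_diagOp_paramQuot_apply (hV : IsSolutionFamily lam b δ K G V) {h : ℝ} (hh : h ≠ 0)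
    (y ξ : Euc d) :
    fderiv ℝ (diagOp lam b (paramQuot V x e h)) y ξ =
      δ * fderiv ℝ (paramQuot V x e h) y ξ +
      (h⁻¹ • (fderiv ℝ G (jet V (x + h • e) y) - fderiv ℝ G (jet V x y)))
        (fderiv ℝ (jet V x) y ξ) +
      fderiv ℝ G (jet V (x + h • e) y)
        (0, 0, fderiv ℝ (fderiv ℝ (paramQuot V x e h)) y ξ) := by
  rw [(hV.hasFDerivAt_diagOp_paramQuot x e h y).fderiv]
  have h1 : fderiv ℝ (jet V (x + h • e)) y ξ = fderiv ℝ (jet V x) y ξ +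
      h • (0, 0, fderiv ℝ (fderiv ℝ (paramQuot V x e h)) y ξ) := by
    simp [hV.fderiv_jet_apply, hV.fderiv_fderiv_paramQuot, smul_smul, hh]
  simp only [add_apply, sub_apply, smul_apply, ContinuousLinearMap.comp_apply, h1, map_add,
    map_smul, smul_eq_mul]
  field_simp
  ring

theorem exists_forall_norm_fderiv_jet_le (hV : IsSolutionFamily lam b δ K G V) :
    ∃ C > 0, ∀ y ∈ unitCube d, ‖fderiv ℝ (jet V x) y‖ ≤ C ∧
      ∀ ξ, ‖fderiv ℝ (fderiv ℝ G) (jet V x y) ξ‖ ≤ C * ‖ξ‖ := by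
  obtain ⟨C₁, h₁⟩ := (isCompact_unitCube d).exists_bound_of_continuousOn
    ((hV.contDiff_jet x).continuous_fderiv one_ne_zero).continuousOn
  obtain ⟨C₂, h₂⟩ := ((isCompact_unitCube d).image (hV.continuous_jet x)
    ).exists_forall_norm_fderiv_apply_le hV.contDiff_fderiv_ham
  refine ⟨max 1 (max C₁ C₂), by positivity, fun y hy => ⟨(h₁ y hy).trans ?_, fun ξ =>
    (h₂ _ (Set.mem_image_of_mem _ hy) ξ).trans (mul_le_mul_of_nonneg_right ?_ (norm_nonneg _))⟩⟩
  · exact (le_max_left _ _).trans (le_max_right _ _)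
  · exact (le_max_right _ _).trans (le_max_right _ _)

theorem exists_eventually_fderiv_fderiv_paramQuot_le (hV : IsSolutionFamily lam b δ K G V) :
    ∃ C > 0, ∀ᶠ h : ℝ in 𝓝[≠] 0, ∀ y, ‖fderiv ℝ (fderiv ℝ (paramQuot V x e h)) y‖ ≤ C := by
  obtain ⟨C, hC, hb⟩ := exists_c2_bound (b := b) hV.lam_pos hV.lip_pos.le
  obtain ⟨C₁, hC₁, hb₁⟩ := hV.exists_paramQuot_bound x e
  obtain ⟨C₂, hC₂, hb₂⟩ := hV.exists_forall_norm_fderiv_jet_le x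
  have hδ := hV.discount_pos
  refine ⟨C * (δ * C₁ + (1 + C₂ * C₁) * C₂ + C₁), by positivity, ?_⟩
  filter_upwards [hV.eventually_norm_quot_sub_fderiv_le x e hV.contDiff_fderiv_ham one_pos,
    self_mem_nhdsWithin] with h hP hh0
  have hh0 : h ≠ 0 := hh0
  refine hb _ _ (by positivity) (hV.contDiff_paramQuot x e h) (hV.torusPeriodic_paramQuot x e h)
    (fun y => (hb₁ h hh0 y).1.trans (le_add_of_nonneg_left (by positivity)))
    (fun y => (hV.hasFDerivAt_diagOp_paramQuot x e h y).differentiableAt) fun y hy => ?_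
  have hP' : ‖h⁻¹ • (fderiv ℝ G (jet V (x + h • e) y) - fderiv ℝ G (jet V x y))‖ ≤
      1 + C₂ * C₁ := by
    have h1 := hP y hy
    have h2 := ((hb₂ y hy).2 _).trans (mul_le_mul_of_nonneg_left (hb₁ h hh0 y).2 hC₂.le)
    exact norm_le_add_of_norm_sub_le h1 h2
  refine ContinuousLinearMap.opNorm_le_bound _ (by have := hV.lip_pos; positivity) fun ξ => ?_
  rw [hV.fderiv_diagOp_paramQuot_apply x e hh0]
  have t1 : ‖δ * fderiv ℝ (paramQuot V x e h) y ξ‖ ≤ δ * (C₁ * ‖ξ‖) := by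
    rw [norm_mul, Real.norm_of_nonneg hδ.le]
    gcongr
    exact ContinuousLinearMap.le_of_opNorm_le _ (hb₁ h hh0 y).1 ξ
  have t2 := ContinuousLinearMap.le_of_opNorm_le_of_le _ hP'
    (ContinuousLinearMap.le_of_opNorm_le _ (hb₂ y hy).1 ξ)
  have t3 : ‖fderiv ℝ G (jet V (x + h • e) y)
      (0, 0, fderiv ℝ (fderiv ℝ (paramQuot V x e h)) y ξ)‖ ≤
      K * (‖fderiv ℝ (fderiv ℝ (paramQuot V x e h)) y‖ * ‖ξ‖) :=
    (hV.abs_fderiv_ham_apply_le _ _).trans (mul_le_mul_of_nonneg_left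
      (ContinuousLinearMap.le_opNorm _ ξ) hV.lip_pos.le)
  refine (norm_add₃_le.trans (add_le_add (add_le_add t1 t2) t3)).trans ?_
  have : 0 ≤ C₁ * ‖ξ‖ := by positivity
  linarith

theorem eventually_fderiv_fderiv_paramQuot_sub_le (hV : IsSolutionFamily lam b δ K G V)
    {ε : ℝ} (hε : 0 < ε) :
    ∀ᶠ p : ℝ × ℝ in 𝓝[≠] 0 ×ˢ 𝓝[≠] 0, ∀ y,
      ‖fderiv ℝ (fderiv ℝ (paramQuot V x e p.1)) y -
        fderiv ℝ (fderiv ℝ (paramQuot V x e p.2)) y‖ ≤ ε := by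
  obtain ⟨C, hC, hb⟩ := exists_c2_bound (b := b) hV.lam_pos hV.lip_pos.le
  obtain ⟨C₂, hC₂, hb₂⟩ := hV.exists_forall_norm_fderiv_jet_le x
  obtain ⟨C₃, hC₃, hb₃⟩ := hV.exists_eventually_fderiv_fderiv_paramQuot_le x e
  have hδ := hV.discount_pos
  obtain ⟨g, hg⟩ : ∃ g, g = ε / C := ⟨_, rfl⟩
  have hg0 : 0 < g := by rw [hg]; positivity
  obtain ⟨D, hD⟩ : ∃ D, D = δ + (2 + C₂) * C₂ + 2 * C₃ + 1 := ⟨_, rfl⟩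
  have hD1 : 1 ≤ D := by
    rw [hD]; exact le_add_of_nonneg_left (by positivity)
  obtain ⟨τ, hτ⟩ : ∃ τ, τ = g / D := ⟨_, rfl⟩
  have hτ0 : 0 < τ := by rw [hτ]; positivity
  have hDτ : D * τ = g := by rw [hτ]; field_simp
  have hτg : τ ≤ g := by nlinarith
  have hlim : Tendsto (fun h : ℝ => x + h • e) (𝓝[≠] 0) (𝓝 x) := by
    have : Continuous fun h : ℝ => x + h • e := by fun_prop
    exact (this.tendsto' 0 x (by simp)).mono_left nhdsWithin_le_nhds
  have ev1 := (hV.eventually_norm_quot_sub_fderiv_le x e hV.contDiff_fderiv_ham hτ0)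
  have ev2 := hlim.eventually (hV.exists_forall_norm_comp_jet_sub_le
    hV.contDiff_fderiv_ham.continuous x hτ0)
  have ev := (ev1.and ev2).and (hb₃.and self_mem_nhdsWithin)
  filter_upwards [ev.prod_mk ev, hV.eventually_paramQuot_sub_le x e hτ0]
    with p ⟨⟨⟨hP1, hJ1⟩, hB1, hn1⟩, ⟨hP2, hJ2⟩, hB2, hn2⟩ hq y
  have hn1 : p.1 ≠ 0 := hn1
  have hn2 : p.2 ≠ 0 := hn2
  have hc (h : ℝ) := hV.contDiff_paramQuot x e h
  have hd (h : ℝ) (y) : DifferentiableAt ℝ (paramQuot V x e h) y :=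
    (hc h).differentiable (by norm_num) y
  have hT (h : ℝ) (y) := (hV.hasFDerivAt_diagOp_paramQuot x e h y).differentiableAt
  have hdiag := funext (diagOp_sub (lam := lam) (b := b) (hc p.1) (hc p.2))
  have key := hb (fun y => paramQuot V x e p.1 y - paramQuot V x e p.2 y) g hg0
    ((hc _).sub (hc _))
    ((hV.torusPeriodic_paramQuot x e _).sub (hV.torusPeriodic_paramQuot x e _))
    (fun y => by
      rw [fderiv_fun_sub (hd _ y) (hd _ y)]
      exact (hq y).2.trans hτg)
    (by
      rw [hdiag]
      exact fun y => (hT _ y).sub (hT _ y))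
    (fun y hy => by
      rw [hdiag, fderiv_fun_sub (hT _ y) (hT _ y), fderiv_fderiv_sub (hc _) (hc _)]
      refine ContinuousLinearMap.opNorm_le_bound _ (by have := hV.lip_pos; positivity)
        fun ξ => ?_
      rw [sub_apply, hV.fderiv_diagOp_paramQuot_apply x e hn1,
        hV.fderiv_diagOp_paramQuot_apply x e hn2]
      have hPP : ‖p.1⁻¹ • (fderiv ℝ G (jet V (x + p.1 • e) y) - fderiv ℝ G (jet V x y)) -
          p.2⁻¹ • (fderiv ℝ G (jet V (x + p.2 • e) y) - fderiv ℝ G (jet V x y))‖ ≤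
          (2 + C₂) * τ := by
        have a1 := hP1 y hy
        have a2 := hP2 y hy
        have a3 : ((0, 0, fderiv ℝ (paramQuot V x e p.1) y - fderiv ℝ (paramQuot V x e p.2) y) :
            Euc d × Euc d × (Euc d →L[ℝ] ℝ)) = (e, 0, fderiv ℝ (paramQuot V x e p.1) y) -
              (e, 0, fderiv ℝ (paramQuot V x e p.2) y) := by
          simp
        have a4 : ‖fderiv ℝ (fderiv ℝ G) (jet V x y) (0, 0,
            fderiv ℝ (paramQuot V x e p.1) y - fderiv ℝ (paramQuot V x e p.2) y)‖ ≤ C₂ * τ :=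
          ((hb₂ y hy).2 _).trans (mul_le_mul_of_nonneg_left
            (by simpa [Prod.norm_def] using (hq y).2) hC₂.le)
        rw [a3, map_sub] at a4
        exact (norm_sub_le_add_add_of_norm_sub_le a1 a2 a4).trans (le_of_eq (by ring))
      have hJJ : ‖fderiv ℝ G (jet V (x + p.1 • e) y) - fderiv ℝ G (jet V (x + p.2 • e) y)‖ ≤
          2 * τ := by
        rw [two_mul]
        exact norm_sub_le_add_of_norm_sub_le (hJ1 y hy) (hJ2 y hy)
      have t1 : ‖δ * (fderiv ℝ (paramQuot V x e p.1) y - fderiv ℝ (paramQuot V x e p.2) y) ξ‖ ≤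
          δ * (τ * ‖ξ‖) := by
        rw [norm_mul, Real.norm_of_nonneg hδ.le]
        gcongr
        exact ContinuousLinearMap.le_of_opNorm_le _ (hq y).2 ξ
      have t2 := ContinuousLinearMap.le_of_opNorm_le_of_le _ hPP
        (ContinuousLinearMap.le_of_opNorm_le _ (hb₂ y hy).1 ξ)
      have t3 : ‖fderiv ℝ G (jet V (x + p.1 • e) y) (0, 0,
          (fderiv ℝ (fderiv ℝ (paramQuot V x e p.1)) y -
            fderiv ℝ (fderiv ℝ (paramQuot V x e p.2)) y) ξ)‖ ≤
          K * (‖fderiv ℝ (fderiv ℝ (paramQuot V x e p.1)) y -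
            fderiv ℝ (fderiv ℝ (paramQuot V x e p.2)) y‖ * ‖ξ‖) :=
        (hV.abs_fderiv_ham_apply_le _ _).trans (mul_le_mul_of_nonneg_left
          (ContinuousLinearMap.le_opNorm _ ξ) hV.lip_pos.le)
      have t4 : ‖(fderiv ℝ G (jet V (x + p.1 • e) y) - fderiv ℝ G (jet V (x + p.2 • e) y))
          (0, 0, fderiv ℝ (fderiv ℝ (paramQuot V x e p.2)) y ξ)‖ ≤ 2 * τ * (C₃ * ‖ξ‖) :=
        ContinuousLinearMap.le_of_opNorm_le_of_le _ hJJ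
          (by simpa [Prod.norm_def] using ContinuousLinearMap.le_of_opNorm_le _ (hB2 y) ξ)
      have t5 := norm_add₃_le.trans (add_le_add (add_le_add t1 t2)
        ((norm_add_le _ _).trans (add_le_add t3 t4)))
      have hsplit : ((0, 0, (fderiv ℝ (fderiv ℝ (paramQuot V x e p.1)) y -
          fderiv ℝ (fderiv ℝ (paramQuot V x e p.2)) y) ξ) : Euc d × Euc d × (Euc d →L[ℝ] ℝ)) =
          (0, 0, fderiv ℝ (fderiv ℝ (paramQuot V x e p.1)) y ξ) -
          (0, 0, fderiv ℝ (fderiv ℝ (paramQuot V x e p.2)) y ξ) := by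
        simp
      refine (le_of_eq ?_).trans (t5.trans ?_)
      · congr 1
        rw [hsplit]
        simp only [map_sub, sub_apply]
        ring
      · have hge : δ * (τ * ‖ξ‖) + (2 + C₂) * τ * (C₂ * ‖ξ‖) + 2 * τ * (C₃ * ‖ξ‖) ≤
            g * ‖ξ‖ := by
          rw [← hDτ, hD]
          have : 0 ≤ τ * ‖ξ‖ := by positivity
          linarith
        linarith) y
  rw [fderiv_fderiv_sub (hc _) (hc _), hg, mul_div_cancel₀ _ hC.ne'] at key
  exact key

end ParamQuot

end IsSolutionFamily

theorem TendstoUniformly.exists_of_cauchy {ι α F : Type*} [NormedAddCommGroup F] [CompleteSpace F]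
    {f : ι → α → F} {l : Filter ι} [l.NeBot]
    (h : ∀ ε > 0, ∀ᶠ p : ι × ι in l ×ˢ l, ∀ a, ‖f p.1 a - f p.2 a‖ ≤ ε) :
    ∃ g, TendstoUniformly f g l := by
  have hu : UniformCauchySeqOn f l Set.univ := fun u hu => by
    obtain ⟨ε, hε, hεu⟩ := Metric.mem_uniformity_dist.1 hu
    filter_upwards [h (ε / 2) (by positivity)] with p hp a _
    refine hεu ?_
    rw [dist_eq_norm]
    exact (hp a).trans_lt (by linarith)
  choose g hg using fun a => CompleteSpace.complete (hu.cauchy_map (Set.mem_univ a))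
  exact ⟨g, tendstoUniformlyOn_univ.1 (hu.tendstoUniformlyOn_of_tendsto fun a _ => hg a)⟩

theorem continuous_uncurry_of_eventually_norm_sub_le {X Y F : Type*} [TopologicalSpace X]
    [TopologicalSpace Y] [NormedAddCommGroup F] {f : X → Y → F} (hf : ∀ x, Continuous (f x))
    (h : ∀ x, ∀ ε > 0, ∀ᶠ x' in 𝓝 x, ∀ y, ‖f x' y - f x y‖ ≤ ε) :
    Continuous fun z : X × Y => f z.1 z.2 := by
  refine continuous_iff_continuousAt.2 fun z => ?_
  have hu : TendstoUniformly (fun (z : X × Y) y => f z.1 y) (f z.1) (𝓝 z) :=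
    Metric.tendstoUniformly_iff.2 fun ε hε => by
      filter_upwards [continuousAt_fst.eventually (h z.1 (ε / 2) (by positivity))] with z' hz' y
      rw [dist_comm, dist_eq_norm]
      exact (hz' y).trans_lt (by linarith)
  exact hu.tendsto_comp (hf z.1).continuousAt continuousAt_snd

namespace IsSolutionFamily

variable {d : ℕ} {lam : Fin d → ℝ} {b : OrthonormalBasis (Fin d) ℝ (Euc d)} {δ K : ℝ}
  {G : Euc d × Euc d × (Euc d →L[ℝ] ℝ) → ℝ} {V : Euc d → Euc d → ℝ}

theorem exists_tendsto_paramQuot (hV : IsSolutionFamily lam b δ K G V) (x e : Euc d) :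
    ∃ W : Euc d → ℝ, ContDiff ℝ 2 W ∧
      (∀ y, Tendsto (fun h => paramQuot V x e h y) (𝓝[≠] 0) (𝓝 (W y))) ∧
      (∀ y, Tendsto (fun h => fderiv ℝ (paramQuot V x e h) y) (𝓝[≠] 0) (𝓝 (fderiv ℝ W y))) ∧
      ∀ y, Tendsto (fun h => fderiv ℝ (fderiv ℝ (paramQuot V x e h)) y) (𝓝[≠] 0)
        (𝓝 (fderiv ℝ (fderiv ℝ W) y)) := by
  obtain ⟨W, hW⟩ := TendstoUniformly.exists_of_cauchy (f := fun h y => paramQuot V x e h y)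
    (l := 𝓝[≠] 0) fun ε hε =>
      (hV.eventually_paramQuot_sub_le x e hε).mono fun p hp y => (hp y).1
  obtain ⟨W₁, hW₁⟩ := TendstoUniformly.exists_of_cauchy
    (f := fun h y => fderiv ℝ (paramQuot V x e h) y)
    (l := 𝓝[≠] 0) fun ε hε =>
      (hV.eventually_paramQuot_sub_le x e hε).mono fun p hp y => (hp y).2
  obtain ⟨W₂, hW₂⟩ := TendstoUniformly.exists_of_cauchy
    (f := fun h y => fderiv ℝ (fderiv ℝ (paramQuot V x e h)) y)
    (l := 𝓝[≠] 0) fun ε hε => hV.eventually_fderiv_fderiv_paramQuot_sub_le x e hε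
  have hc (h : ℝ) := hV.contDiff_paramQuot x e h
  have hd₁ (y) : HasFDerivAt W (W₁ y) y := hasFDerivAt_of_tendstoUniformly hW₁
    (fun h y => ((hc h).differentiable (by norm_num) y).hasFDerivAt)
    (fun y => hW.tendsto_at y) y
  have hd₂ (y) : HasFDerivAt W₁ (W₂ y) y := hasFDerivAt_of_tendstoUniformly hW₂
    (fun h y => ((hc h).differentiable_fderiv_of_two y).hasFDerivAt)
    (fun y => hW₁.tendsto_at y) y
  have hcont : Continuous W₂ := hW₂.continuous (Eventually.of_forall fun h =>
    ((hc h).fderiv_right (m := 1) (by norm_num)).continuous_fderiv one_ne_zero).frequently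
  have e₁ : fderiv ℝ W = W₁ := funext fun y => (hd₁ y).fderiv
  have e₂ : fderiv ℝ W₁ = W₂ := funext fun y => (hd₂ y).fderiv
  refine ⟨W, ?_, fun y => hW.tendsto_at y, fun y => ?_, fun y => ?_⟩
  · refine (contDiff_succ_iff_fderiv (n := 1)).2 ⟨fun y => (hd₁ y).differentiableAt, by simp, ?_⟩
    rw [e₁]
    refine contDiff_one_iff_fderiv.2 ⟨fun y => (hd₂ y).differentiableAt, ?_⟩
    rwa [e₂]
  · rw [e₁]
    exact hW₁.tendsto_at y
  · rw [e₁, e₂]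
    exact hW₂.tendsto_at y

theorem exists_paramDeriv (hV : IsSolutionFamily lam b δ K G V) (e : Euc d) :
    ∃ W : Euc d → Euc d → ℝ, (∀ x, ContDiff ℝ 2 (W x)) ∧ (∀ x, TorusPeriodic (W x)) ∧
      (∀ x y, HasDerivAt (fun t : ℝ => V (x + t • e) y) (W x y) 0) ∧
      (∀ x y, HasDerivAt (fun t : ℝ => fderiv ℝ (V (x + t • e)) y) (fderiv ℝ (W x) y) 0) ∧
      ∀ x y, δ * W x y - diagOp lam b (W x) y +
        fderiv ℝ G (jet V x y) (e, 0, fderiv ℝ (W x) y) = 0 := by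
  choose W hW h₀ h₁ h₂ using fun x => hV.exists_tendsto_paramQuot x e
  have hd₀ (x y : Euc d) : HasDerivAt (fun t : ℝ => V (x + t • e) y) (W x y) 0 := by
    rw [hasDerivAt_iff_tendsto_slope_zero]
    simpa [paramQuot] using h₀ x y
  have hd₁ (x y : Euc d) :
      HasDerivAt (fun t : ℝ => fderiv ℝ (V (x + t • e)) y) (fderiv ℝ (W x) y) 0 := by
    rw [hasDerivAt_iff_tendsto_slope_zero]
    simpa [hV.fderiv_paramQuot] using h₁ x y
  refine ⟨W, hW, fun x y y' hy => ?_, hd₀, hd₁, fun x y => ?_⟩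
  · refine tendsto_nhds_unique (h₀ x y) ?_
    simpa only [hV.torusPeriodic_paramQuot x e _ y y' hy] using h₀ x y'
  · have hdiag : Tendsto (fun h => diagOp lam b (paramQuot V x e h) y) (𝓝[≠] 0)
        (𝓝 (diagOp lam b (W x) y)) :=
      tendsto_finsetSum _ fun l _ => Tendsto.const_mul _
        ((((ContinuousLinearMap.apply ℝ ℝ (b l)).comp
          (ContinuousLinearMap.apply ℝ (Euc d →L[ℝ] ℝ) (b l))).continuous.tendsto _).comp
            (h₂ x y))
    have hjet : HasDerivAt (fun t : ℝ => jet V (x + t • e) y) (e, 0, fderiv ℝ (W x) y) 0 := by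
      have hx : HasDerivAt (fun t : ℝ => x + t • e) e 0 := by
        simpa using ((hasDerivAt_id (0 : ℝ)).smul_const e).const_add x
      exact hx.prodMk ((hasDerivAt_const _ y).prodMk (hd₁ x y))
    have hG : HasFDerivAt G (fderiv ℝ G (jet V x y)) (jet V (x + (0 : ℝ) • e) y) := by
      rw [zero_smul, add_zero]
      exact (hV.contDiff_ham.differentiable (by norm_num) _).hasFDerivAt
    have hGj := hasDerivAt_iff_tendsto_slope_zero.1 (hG.comp_hasDerivAt 0 hjet)
    have hlim := ((h₀ x y).const_mul δ).add hGj
    have heq := tendsto_nhds_unique hdiag (hlim.congr fun h => by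
      rw [hV.diagOp_paramQuot]
      simp)
    rw [heq]
    ring

theorem eventually_norm_paramDeriv_sub_le (hV : IsSolutionFamily lam b δ K G V) {e : Euc d}
    {W : Euc d → Euc d → ℝ} (hW : ∀ x, ContDiff ℝ 2 (W x)) (hper : ∀ x, TorusPeriodic (W x))
    (heq : ∀ x y, δ * W x y - diagOp lam b (W x) y +
      fderiv ℝ G (jet V x y) (e, 0, fderiv ℝ (W x) y) = 0) (x : Euc d) {ε : ℝ} (hε : 0 < ε) :
    ∀ᶠ x' in 𝓝 x, ∀ y, |W x' y - W x y| ≤ ε ∧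
      ‖fderiv ℝ (W x') y - fderiv ℝ (W x) y‖ ≤ ε := by
  obtain ⟨C, hC, hb⟩ := exists_c1_bound (b := b) hV.lam_pos hV.discount_pos hV.lip_pos.le
  obtain ⟨B, hB⟩ := (isCompact_unitCube d).exists_bound_of_continuousOn
    (f := fun y => ((e, 0, fderiv ℝ (W x) y) : Euc d × Euc d × (Euc d →L[ℝ] ℝ)))
    (continuous_const.prodMk (continuous_const.prodMk
      ((hW x).continuous_fderiv (by norm_num)))).continuousOn
  obtain ⟨g, hg⟩ : ∃ g, g = ε / C := ⟨_, rfl⟩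
  have hg0 : 0 < g := by rw [hg]; positivity
  have hη : 0 < g / (|B| + 1) := by positivity
  filter_upwards [hV.exists_forall_norm_comp_jet_sub_le hV.contDiff_fderiv_ham.continuous x hη]
    with x' hx' y
  have hd (x) (y) : DifferentiableAt ℝ (W x) y := (hW x).differentiable (by norm_num) y
  have key := hb (fun y => W x' y - W x y) g hg0 ((hW x').sub (hW x)) ((hper x').sub (hper x))
    (fun y hy => by
      rw [diagOp_sub (hW x') (hW x), fderiv_fun_sub (hd _ y) (hd _ y)]
      have a1 := hV.abs_fderiv_ham_apply_le (jet V x' y) (fderiv ℝ (W x') y - fderiv ℝ (W x) y)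
      have a2 : ‖(fderiv ℝ G (jet V x' y) - fderiv ℝ G (jet V x y))
          (e, 0, fderiv ℝ (W x) y)‖ ≤ g / (|B| + 1) * (|B| + 1) :=
        ContinuousLinearMap.le_of_opNorm_le_of_le _ (hx' y hy)
          ((hB y hy).trans ((le_abs_self B).trans (by linarith)))
      rw [div_mul_cancel₀ _ (by positivity), sub_apply] at a2
      have a3 : ((0, 0, fderiv ℝ (W x') y - fderiv ℝ (W x) y) :
          Euc d × Euc d × (Euc d →L[ℝ] ℝ)) =
          (e, 0, fderiv ℝ (W x') y) - (e, 0, fderiv ℝ (W x) y) := by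
        simp
      rw [a3, map_sub] at a1
      have e1 := heq x y
      have e2 := heq x' y
      rw [Real.norm_eq_abs, abs_le] at a2
      rw [abs_le] at a1 ⊢
      constructor <;> linarith) y
  rw [fderiv_fun_sub (hd _ y) (hd _ y), hg, mul_div_cancel₀ _ hC.ne'] at key
  exact key

end IsSolutionFamily

theorem Matrix.PosDef.exists_eigenbasis {d : ℕ} {a : Matrix (Fin d) (Fin d) ℝ} (ha : a.PosDef) :
    ∃ (lam : Fin d → ℝ) (b : OrthonormalBasis (Fin d) ℝ (Euc d)), (∀ l, 0 < lam l) ∧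
      ∀ i j, a i j = ∑ l, lam l * (b l i * b l j) := by
  refine ⟨ha.1.eigenvalues, ha.1.eigenvectorBasis, ha.eigenvalues_pos, fun i j => ?_⟩
  have h := congrFun (congrFun ha.1.spectral_theorem i) j
  rw [h, Unitary.conjStarAlgAut_apply, Matrix.mul_apply]
  refine Finset.sum_congr rfl fun l _ => ?_
  rw [Matrix.mul_diagonal]
  simp [Matrix.star_apply]
  ring

theorem trAH_eq_diagOp {d : ℕ} {a : Matrix (Fin d) (Fin d) ℝ} {lam : Fin d → ℝ}
    {b : OrthonormalBasis (Fin d) ℝ (Euc d)}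
    (hab : ∀ i j, a i j = ∑ l, lam l * (b l i * b l j)) (u : Euc d → ℝ) :
    trAH a u = diagOp lam b u := by
  funext y
  have hb (l : Fin d) : b l = ∑ i, b l i • (EuclideanSpace.single i 1 : Euc d) := by
    ext j
    simp [Pi.single_apply]
  have hB (l : Fin d) : fderiv ℝ (fderiv ℝ u) y (b l) (b l) =
      ∑ i, ∑ j, b l i * b l j * hess u y j i := by
    conv_lhs => rw [hb l]
    simp only [map_sum, map_smul, sum_apply, smul_apply, hess, iteratedFDeriv_two_apply,
      Finset.mul_sum, smul_eq_mul, Matrix.cons_val_zero, Matrix.cons_val_one, mul_assoc]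
  simp only [trAH, diagOp, hab, hB, Finset.sum_mul, Finset.mul_sum]
  rw [Finset.sum_comm_cycle]
  simp only [mul_assoc]

/-- The Riesz isomorphism, as a continuous linear map, that turns derivatives into gradients. -/
def rieszMap (d : ℕ) : (Euc d →L[ℝ] ℝ) →L[ℝ] Euc d :=
  LinearMap.mkContinuous
    { toFun := (InnerProductSpace.toDual ℝ (Euc d)).symm
      map_add' := map_add _
      map_smul' := fun r l => by simp } 1 (fun l => by simp)

theorem norm_rieszMap {d : ℕ} (l : Euc d →L[ℝ] ℝ) : ‖rieszMap d l‖ = ‖l‖ :=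
  (InnerProductSpace.toDual ℝ (Euc d)).symm.norm_map l

theorem abs_sSup_image_sub_le {α : Type*} {A : Set α} {φ ψ : α → ℝ} {r : ℝ} (hr : 0 ≤ r)
    (hφ : BddAbove (φ '' A)) (hψ : BddAbove (ψ '' A)) (h : ∀ t ∈ A, |φ t - ψ t| ≤ r) :
    |sSup (φ '' A) - sSup (ψ '' A)| ≤ r := by
  rcases A.eq_empty_or_nonempty with rfl | hA
  · simpa using hr
  have h1 : sSup (φ '' A) ≤ sSup (ψ '' A) + r := by
    refine csSup_le (hA.image _) ?_
    rintro _ ⟨t, ht, rfl⟩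
    have := le_csSup hψ (Set.mem_image_of_mem ψ ht)
    linarith [(abs_le.1 (h t ht)).2]
  have h2 : sSup (ψ '' A) ≤ sSup (φ '' A) + r := by
    refine csSup_le (hA.image _) ?_
    rintro _ ⟨t, ht, rfl⟩
    have := le_csSup hφ (Set.mem_image_of_mem φ ht)
    linarith [(abs_le.1 (h t ht)).1]
  rw [abs_le]
  constructor <;> linarith

theorem exists_lipschitz_bellman {d : ℕ} {A : Set (Euc (2 * d))} (hA : IsCompact A)
    {c f : Torus d → Torus d → Euc (2 * d) → Euc d} {L : Torus d → Torus d → Euc (2 * d) → ℝ}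
    (hc : Continuous fun z : Torus d × Torus d × Euc (2 * d) => c z.1 z.2.1 z.2.2)
    (hf : Continuous fun z : Torus d × Torus d × Euc (2 * d) => f z.1 z.2.1 z.2.2)
    (hL : Continuous fun z : Torus d × Torus d × Euc (2 * d) => L z.1 z.2.1 z.2.2)
    {H : Torus d → Torus d → Euc d → Euc d → ℝ}
    (hH : ∀ x y p q, H x y p q =
      sSup ((fun α => -⟪p, c x y α⟫ - ⟪q, f x y α⟫ - L x y α) '' A)) :
    ∃ B, 0 ≤ B ∧ ∀ x y p q q', |H x y p q - H x y p q'| ≤ B * ‖q - q'‖ := by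
  obtain ⟨B, hB⟩ := ((isCompact_univ (X := Torus d)).prod
    ((isCompact_univ (X := Torus d)).prod hA)).exists_bound_of_continuousOn hf.continuousOn
  have hslice (x y : Torus d) : Continuous fun α : Euc (2 * d) => (x, y, α) := by fun_prop
  have hbdd (x y : Torus d) (p q : Euc d) :
      BddAbove ((fun α => -⟪p, c x y α⟫ - ⟪q, f x y α⟫ - L x y α) '' A) := by
    have h1 := hc.comp (hslice x y)
    have h2 := hf.comp (hslice x y)
    have h3 := hL.comp (hslice x y)
    exact hA.bddAbove_image (((continuous_const.inner h1).neg.sub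
      (continuous_const.inner h2)).sub h3).continuousOn
  refine ⟨|B|, abs_nonneg B, fun x y p q q' => ?_⟩
  rw [hH, hH]
  refine abs_sSup_image_sub_le (by positivity) (hbdd x y p q) (hbdd x y p q') fun α hα => ?_
  have h1 : -⟪p, c x y α⟫ - ⟪q, f x y α⟫ - L x y α - (-⟪p, c x y α⟫ - ⟪q', f x y α⟫ - L x y α) =
      - ⟪q - q', f x y α⟫ := by
    rw [inner_sub_left]
    ring
  rw [h1, abs_neg, mul_comm]
  refine (abs_real_inner_le_norm _ _).trans (mul_le_mul_of_nonneg_left ?_ (norm_nonneg _))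
  exact (hB (x, y, α) ⟨trivial, trivial, hα⟩).trans (le_abs_self B)

theorem fderiv_apply_split {E F G : Type*} [NormedAddCommGroup E] [NormedSpace ℝ E]
    [NormedAddCommGroup F] [NormedSpace ℝ F] [NormedAddCommGroup G] [NormedSpace ℝ G]
    {Φ : E × F × G → ℝ} (hΦ : Differentiable ℝ Φ) (x e : E) (y : F) (l ξ : G) :
    fderiv ℝ Φ (x, y, l) (e, 0, ξ) =
      deriv (fun t : ℝ => Φ (x + t • e, y, l)) 0 + fderiv ℝ (fun l => Φ (x, y, l)) l ξ := by
  have h1 : HasDerivAt (fun t : ℝ => (x + t • e, y, l)) (e, 0, 0) 0 := by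
    have hx : HasDerivAt (fun t : ℝ => x + t • e) e 0 := by
      simpa using ((hasDerivAt_id (0 : ℝ)).smul_const e).const_add x
    exact hx.prodMk (hasDerivAt_const _ (y, l))
  have h2 : HasFDerivAt (fun l : G => (x, y, l))
      ((0 : G →L[ℝ] E).prod ((0 : G →L[ℝ] F).prod (ContinuousLinearMap.id ℝ G))) l :=
    (hasFDerivAt_const x l).prodMk ((hasFDerivAt_const y l).prodMk (hasFDerivAt_id l))
  have hΦ0 : HasFDerivAt Φ (fderiv ℝ Φ (x, y, l)) (x + (0 : ℝ) • e, y, l) := by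
    rw [zero_smul, add_zero]
    exact (hΦ _).hasFDerivAt
  have d1 := (hΦ0.comp_hasDerivAt 0 h1).deriv
  have d2 := ((hΦ (x, y, l)).hasFDerivAt.comp l h2).fderiv
  have e1 : deriv (fun t : ℝ => Φ (x + t • e, y, l)) 0 = fderiv ℝ Φ (x, y, l) (e, 0, 0) := d1
  have e2 : fderiv ℝ (fun l => Φ (x, y, l)) l ξ = fderiv ℝ Φ (x, y, l) (0, 0, ξ) :=
    congrArg (fun T : G →L[ℝ] ℝ => T ξ) d2
  rw [e1, e2, ← map_add]
  simp

/-- The Bellman Hamiltonian at fixed `p` and `μ`, as a function of a jet. -/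
def jetHam {d : ℕ} (F : Torus d → Torus d → Euc d → ℝ)
    (z : Euc d × Euc d × (Euc d →L[ℝ] ℝ)) : ℝ :=
  F (Torus.proj z.1) (Torus.proj z.2.1) (rieszMap d z.2.2)

theorem fderiv_jetHam_apply {d : ℕ} {F : Torus d → Torus d → Euc d → ℝ}
    (hF : ContDiff ℝ 2 (jetHam F))
    (hq : ∀ x y, Differentiable ℝ (F x y)) (u w : Euc d → ℝ) (x y e : Euc d) :
    fderiv ℝ (jetHam F) (x, y, fderiv ℝ u y) (e, 0, fderiv ℝ w y) =
      deriv (fun t : ℝ => F (Torus.proj (x + t • e)) (Torus.proj y) (gradient u y)) 0 +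
      ⟪gradient (F (Torus.proj x) (Torus.proj y)) (gradient u y), gradient w y⟫ := by
  rw [fderiv_apply_split (hF.differentiable (by norm_num)), inner_gradient_left]
  congr 1
  have h := ((hq (Torus.proj x) (Torus.proj y) (rieszMap d (fderiv ℝ u y))).hasFDerivAt.comp
    (fderiv ℝ u y) (rieszMap d).hasFDerivAt).fderiv
  exact congrArg (fun T : (Euc d →L[ℝ] ℝ) →L[ℝ] ℝ => T (fderiv ℝ w y)) h

theorem Torus.surjective_proj (d : ℕ) : Function.Surjective (Torus.proj : Euc d → Torus d) :=
  (Torus.isOpenQuotientMap_proj d).surjective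

theorem isSolutionFamily_of_isSol {d : ℕ} {a : Matrix (Fin d) (Fin d) ℝ} {lam : Fin d → ℝ}
    {b : OrthonormalBasis (Fin d) ℝ (Euc d)} (hlam : ∀ l, 0 < lam l)
    (hab : ∀ i j, a i j = ∑ l, lam l * (b l i * b l j))
    {H : Torus d → Torus d → Euc d → Euc d → ProbT d → ℝ} {δ : ℝ} (hδ : 0 < δ) {p : Euc d}
    {μ : ProbT d} {v : Torus d → Torus d → ℝ} (hv : ∀ x : Torus d, IsSol a H δ x p μ (v x))
    (hG : ContDiff ℝ 2 (jetHam fun x y q => H x y p q μ)) {B C : ℝ}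
    (hx : ∀ (y q : Euc d), Differentiable ℝ fun x => H (Torus.proj x) (Torus.proj y) p q μ)
    (hx' : ∀ x y q : Euc d,
      ‖fderiv ℝ (fun x => H (Torus.proj x) (Torus.proj y) p q μ) x‖ ≤ C)
    (hB : 0 ≤ B) (hq : ∀ x y q q', |H x y p q μ - H x y p q' μ| ≤ B * ‖q - q'‖) :
    IsSolutionFamily lam b δ (C + B + 1) (jetHam fun x y q => H x y p q μ)
      fun x => tlift (v (Torus.proj x)) where
  lam_pos := hlam
  discount_pos := hδ
  lip_pos := by
    have := (norm_nonneg _).trans (hx' 0 0 0)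
    positivity
  contDiff_ham := hG
  lipschitz x x' y l l' := by
    have hC := (norm_nonneg _).trans (hx' 0 0 0)
    have h1 : ‖H (Torus.proj x) (Torus.proj y) p (rieszMap d l) μ -
        H (Torus.proj x') (Torus.proj y) p (rieszMap d l) μ‖ ≤ C * ‖x - x'‖ :=
      convex_univ.norm_image_sub_le_of_norm_fderiv_le (𝕜 := ℝ)
        (f := fun x => H (Torus.proj x) (Torus.proj y) p (rieszMap d l) μ)
        (fun x _ => hx y _ x) (fun x _ => hx' x y _) trivial trivial
    have h2 := hq (Torus.proj x') (Torus.proj y) (rieszMap d l) (rieszMap d l')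
    rw [← map_sub, norm_rieszMap] at h2
    refine (abs_sub_le _ (H (Torus.proj x') (Torus.proj y) p (rieszMap d l) μ) _).trans
      ((add_le_add h1 h2).trans ?_)
    nlinarith [norm_nonneg (x - x'), norm_nonneg (l - l')]
  contDiff x := (hv _).1
  periodic x := torusPeriodic_tlift _
  equation x y := by
    rw [← trAH_eq_diagOp hab]
    exact (hv _).2 y

theorem IsSolutionFamily.eq_of_linear {d : ℕ} {lam : Fin d → ℝ}
    {b : OrthonormalBasis (Fin d) ℝ (Euc d)} {δ K : ℝ}
    {G : Euc d × Euc d × (Euc d →L[ℝ] ℝ) → ℝ} {V : Euc d → Euc d → ℝ}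
    (hV : IsSolutionFamily lam b δ K G V) {x e : Euc d} {u w : Euc d → ℝ}
    (hu : ContDiff ℝ 2 u) (hw : ContDiff ℝ 2 w) (hup : TorusPeriodic u) (hwp : TorusPeriodic w)
    (hue : ∀ y, δ * u y - diagOp lam b u y + fderiv ℝ G (jet V x y) (e, 0, fderiv ℝ u y) = 0)
    (hwe : ∀ y, δ * w y - diagOp lam b w y + fderiv ℝ G (jet V x y) (e, 0, fderiv ℝ w y) = 0) :
    u = w := by
  funext y
  have h := abs_le_of_forall_abs_diagOp_le (M := K) (g := 0) hV.lam_pos hV.discount_pos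
    (hu.sub hw) (hup.sub hwp) (fun y => by
      rw [diagOp_sub hu hw, fderiv_fun_sub (hu.differentiable (by norm_num) y)
        (hw.differentiable (by norm_num) y), add_zero]
      have h1 := hV.abs_fderiv_ham_apply_le (jet V x y) (fderiv ℝ u y - fderiv ℝ w y)
      have h2 : ((0, 0, fderiv ℝ u y - fderiv ℝ w y) : Euc d × Euc d × (Euc d →L[ℝ] ℝ)) =
          (e, 0, fderiv ℝ u y) - (e, 0, fderiv ℝ w y) := by
        simp
      rw [h2, map_sub] at h1
      have e1 := hue y
      have e2 := hwe y
      rw [abs_le] at h1 ⊢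
      constructor <;> linarith) y
  rw [zero_div] at h
  exact sub_eq_zero.1 (abs_nonpos_iff.1 h)

/-- Differentiability in `x` of the solution `v^δ(x, ·)` of the discounted cell
problem: the partial derivative `∂_{x_i} v^δ` exists everywhere, is continuous in `(x,y)`, is the
unique classical solution of the linearized equation, and the mixed second derivatives
`D²_{xy} v^δ` and `D²_{yx} v^δ` exist, are continuous and coincide. -/
theorem discounted_solution_x_differentiability (d : ℕ)
    -- `a = σ₂σ₂ᵀ + σ_{0,2}σ_{0,2}ᵀ` is a constant symmetric positive definite matrix
    (a : Matrix (Fin d) (Fin d) ℝ) (ha : a.PosDef) (haS : a.IsSymm)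
    -- `A ⊂ ℝ^{2d}` is a compact set of controls
    (A : Set (Euc (2*d))) (hA : IsCompact A)
    -- the data `c, f, L`, continuous and Lipschitz in `(x,y,μ)` uniformly in `α ∈ A`
    (c f : Torus d → Torus d → Euc (2*d) → ProbT d → Euc d)
    (L : Torus d → Torus d → Euc (2*d) → ProbT d → ℝ)
    (hccont : ∀ μ, Continuous fun z : Torus d × Torus d × Euc (2*d) => c z.1 z.2.1 z.2.2 μ)
    (hfcont : ∀ μ, Continuous fun z : Torus d × Torus d × Euc (2*d) => f z.1 z.2.1 z.2.2 μ)
    (hLcont : ∀ μ, Continuous fun z : Torus d × Torus d × Euc (2*d) => L z.1 z.2.1 z.2.2 μ)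
    (K : ℝ)
    (hclip : ∀ x x' y y' α μ μ', α ∈ A →
      ‖c x y α μ - c x' y' α μ'‖ ≤ K * (dist x x' + dist y y' + W1T μ μ'))
    (hflip : ∀ x x' y y' α μ μ', α ∈ A →
      ‖f x y α μ - f x' y' α μ'‖ ≤ K * (dist x x' + dist y y' + W1T μ μ'))
    (hLlip : ∀ x x' y y' α μ μ', α ∈ A →
      |L x y α μ - L x' y' α μ'| ≤ K * (dist x x' + dist y y' + W1T μ μ'))
    -- the Bellman Hamiltonian
    (H : Torus d → Torus d → Euc d → Euc d → ProbT d → ℝ)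
    (hHdef : ∀ x y p q μ,
      H x y p q μ =
        sSup ((fun α => -⟪p, c x y α μ⟫ - ⟪q, f x y α μ⟫ - L x y α μ) '' A))
    (C_H β : ℝ) (hβ0 : 0 < β) (hβ1 : β < 1)
    (hHC2 : ∀ μ, ContDiff ℝ 2
      (fun z : Euc d × Euc d × Euc d × Euc d =>
        H (Torus.proj z.1) (Torus.proj z.2.1) z.2.2.1 z.2.2.2 μ))
    -- with second derivative locally β-Hölder continuous uniformly in `μ`
    (hHholder : ∀ R : ℝ, 0 < R → ∃ C : ℝ, ∀ μ, ∀ z z' : Euc d × Euc d × Euc d × Euc d,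
      ‖z‖ ≤ R → ‖z'‖ ≤ R →
      ‖iteratedFDeriv ℝ 2 (fun w : Euc d × Euc d × Euc d × Euc d =>
          H (Torus.proj w.1) (Torus.proj w.2.1) w.2.2.1 w.2.2.2 μ) z
        - iteratedFDeriv ℝ 2 (fun w : Euc d × Euc d × Euc d × Euc d =>
          H (Torus.proj w.1) (Torus.proj w.2.1) w.2.2.1 w.2.2.2 μ) z'‖
        ≤ C * ‖z - z'‖ ^ β)
    -- `|D_x H| ≤ C_H (1+|p|)` and `|D_p H| ≤ C_H (1+|p|)`
    (hDx : ∀ (x : Euc d) (y : Torus d) (p q : Euc d) (μ : ProbT d),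
      ‖fderiv ℝ (fun x' : Euc d => H (Torus.proj x') y p q μ) x‖ ≤ C_H * (1 + ‖p‖))
    (hDp : ∀ (x y : Torus d) (p q : Euc d) (μ : ProbT d),
      ‖fderiv ℝ (fun p' : Euc d => H x y p' q μ) p‖ ≤ C_H * (1 + ‖p‖))
    (δ : ℝ) (hδ : 0 < δ) (p : Euc d) (μ : ProbT d)
    (v : Torus d → Torus d → ℝ)
    (hv : ∀ x : Torus d, IsSol a H δ x p μ (v x))
    (i : Fin d) :
    ∃ w : Torus d → Torus d → ℝ,
      -- `∂_{x_i} v^δ` is continuous in `(x,y)`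
      Continuous (fun z : Torus d × Torus d => w z.1 z.2) ∧
      -- the partial derivative `∂_{x_i} v^δ(x,y)` exists for all `(x,y)` and equals `w(x,y)`
      (∀ x y : Euc d,
        HasDerivAt
          (fun t : ℝ => v (Torus.proj (x + t • (EuclideanSpace.single i 1 : Euc d))) (Torus.proj y))
          (w (Torus.proj x) (Torus.proj y)) 0) ∧
      -- for each `x`, `w(x,·)` is the unique classical solution of the linearized equation
      (∀ x : Euc d,
        LinSolX a H δ p μ v i x (w (Torus.proj x)) ∧
        ∀ u : Torus d → ℝ, LinSolX a H δ p μ v i x u → u = w (Torus.proj x)) ∧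
      -- the mixed derivatives `∂_{y_j}∂_{x_i} v^δ` and `∂_{x_i}∂_{y_j} v^δ` exist, are
      -- continuous in `(x,y)` and coincide
      (∀ j : Fin d, ∃ m : Euc d → Euc d → ℝ,
        Continuous (fun z : Euc d × Euc d => m z.1 z.2) ∧
        (∀ x y : Euc d,
          HasDerivAt
            (fun t : ℝ => w (Torus.proj x) (Torus.proj (y + t • (EuclideanSpace.single j 1 : Euc d))))
            (m x y) 0) ∧
        (∀ x y : Euc d,
          HasDerivAt
            (fun t : ℝ => deriv (fun s : ℝ =>
              v (Torus.proj (x + t • (EuclideanSpace.single i 1 : Euc d)))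
                (Torus.proj (y + s • (EuclideanSpace.single j 1 : Euc d)))) 0)
            (m x y) 0)) := by
  obtain ⟨lam, b, hlam, hab⟩ := ha.exists_eigenbasis
  obtain ⟨B, hB0, hB⟩ := exists_lipschitz_bellman hA (hccont μ) (hfcont μ) (hLcont μ)
    (H := fun x y p q => H x y p q μ) fun x y p q => hHdef x y p q μ
  have hG : ContDiff ℝ 2 (jetHam fun x y q => H x y p q μ) :=
    (hHC2 μ).comp (contDiff_fst.prodMk (contDiff_snd.fst.prodMk
      (contDiff_const.prodMk ((rieszMap d).contDiff.comp contDiff_snd.snd))))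
  have hx (y q : Euc d) : Differentiable ℝ fun x => H (Torus.proj x) (Torus.proj y) p q μ :=
    ((hHC2 μ).comp (contDiff_id.prodMk (contDiff_const (c := (y, p, q))))).differentiable
      (by norm_num)
  have hq (x y : Torus d) : Differentiable ℝ fun q => H x y p q μ := by
    obtain ⟨x, rfl⟩ := Torus.surjective_proj d x
    obtain ⟨y, rfl⟩ := Torus.surjective_proj d y
    exact ((hHC2 μ).comp (contDiff_const.prodMk (contDiff_const.prodMk
      (contDiff_const.prodMk contDiff_id)))).differentiable (by norm_num)
  have hV := isSolutionFamily_of_isSol hlam hab hδ hv hG hx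
    (fun x y q => hDx x (Torus.proj y) p q μ) hB0 fun x y q q' => hB x y p q q'
  obtain ⟨e, he⟩ : ∃ e : Euc d, e = EuclideanSpace.single i 1 := ⟨_, rfl⟩
  obtain ⟨W, hW, hWper, hWd, hWd', hWeq⟩ := hV.exists_paramDeriv e
  obtain ⟨w, hw⟩ : ∃ w : Torus d → Torus d → ℝ,
      ∀ x y, w (Torus.proj x) (Torus.proj y) = W x y := by
    refine ⟨fun X Y => deriv (fun t : ℝ => v (X + Torus.proj (t • e)) Y) 0, fun x y => ?_⟩
    simp only [← Torus.proj_add]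
    exact (hWd x y).deriv
  have htw (x : Euc d) : tlift (w (Torus.proj x)) = W x := funext (hw x)
  have hlin (u : Torus d → ℝ) (x y : Euc d) :
      (δ * u (Torus.proj y) - trAH a (tlift u) y
        + ⟪gradient (fun q : Euc d => H (Torus.proj x) (Torus.proj y) p q μ)
              (gradient (tlift (v (Torus.proj x))) y),
            gradient (tlift u) y⟫
        = - deriv (fun t : ℝ => H (Torus.proj (x + t • e)) (Torus.proj y) p
              (gradient (tlift (v (Torus.proj x))) y) μ) 0) ↔
      δ * tlift u y - diagOp lam b (tlift u) y +
        fderiv ℝ (jetHam fun x y q => H x y p q μ)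
          (jet (fun x => tlift (v (Torus.proj x))) x y) (e, 0, fderiv ℝ (tlift u) y) = 0 := by
    rw [jet, fderiv_jetHam_apply hG hq, trAH_eq_diagOp hab, eq_neg_iff_add_eq_zero, add_assoc,
      add_comm ⟪_, _⟫]
    rfl
  have hcont {ε : ℝ} (hε : 0 < ε) (x : Euc d) :=
    hV.eventually_norm_paramDeriv_sub_le hW hWper hWeq x hε
  have hDcont : Continuous fun z : Euc d × Euc d => fderiv ℝ (W z.1) z.2 :=
    continuous_uncurry_of_eventually_norm_sub_le
      (fun x => (hW x).continuous_fderiv (by norm_num))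
      fun x ε hε => (hcont hε x).mono fun x' h y => (h y).2
  refine ⟨w, ?_, fun x y => ?_, fun x => ⟨⟨?_, fun y => ?_⟩, fun u hu => ?_⟩, fun j =>
    ⟨fun x y => fderiv ℝ (W x) y (EuclideanSpace.single j 1), ?_, fun x y => ?_, fun x y => ?_⟩⟩
  · rw [((Torus.isOpenQuotientMap_proj d).prodMap
      (Torus.isOpenQuotientMap_proj d)).isQuotientMap.continuous_iff]
    have : Continuous fun z : Euc d × Euc d => W z.1 z.2 :=
      continuous_uncurry_of_eventually_norm_sub_le (fun x => (hW x).continuous)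
        fun x ε hε => (hcont hε x).mono fun x' h y => (h y).1
    exact this.congr fun z => (hw z.1 z.2).symm
  · rw [hw, ← he]
    exact hWd x y
  · rw [htw]
    exact hW x
  · rw [← he, hlin, htw]
    exact hWeq x y
  · have h := hV.eq_of_linear (x := x) (e := e) hu.1 (hW x) (torusPeriodic_tlift u) (hWper x)
      (fun y => (hlin u x y).1 (he ▸ hu.2 y)) (hWeq x)
    funext Y
    obtain ⟨y, rfl⟩ := Torus.surjective_proj d Y
    rw [hw]
    exact congrFun h y
  · exact hDcont.clm_apply continuous_const
  · simp only [hw]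
    simpa using hasDerivAt_line ((hW x).differentiable (by norm_num)) y
      (EuclideanSpace.single j 1) 0
  · rw [← he]
    have h1 (x : Euc d) := (hasDerivAt_line (hV.differentiable x) y
      (EuclideanSpace.single j 1) 0).deriv
    simp only [zero_smul, add_zero, tlift] at h1
    simp only [h1]
    exact (hWd' x y).clm_apply (hasDerivAt_const 0 _) |>.congr_deriv (by simp)
end
end
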